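/- arXiv:1504.05756 — 2 statements merged into one kernel-verified Lean document; each statement's English description precedes it below -/
import Mathlib

section
/- Covering a type class by permutations (Ahlswede's covering lemma): Let 𝒳 be a finite alphabet, n ≥ 1, Q ∈ 𝒫_n(𝒳) a type with |T_n(Q)| ≥ 2, and let D ⊆ T_n(Q) be nonempty. Then there exist permutations π_0, …, π_κ of {1,…,n} with κ + 1 ≤ (|T_n(Q)|/|D|) · log₂|T_n(Q)| such that ∪_{t=0}^{κ} π_t(D) = T_n(Q). -/
open scoped BigOperators

noncomputable section

/-- Empirical distribution (type) of a sequence. -/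
def empDist {A : Type*} [Fintype A] [DecidableEq A] {n : ℕ} (x : Fin n → A) : A → ℝ :=
  fun a => ((Finset.univ.filter fun i => x i = a).card : ℝ) / n

/-- Type class of `Q` among length-`n` sequences. -/
def typeClass (A : Type*) [Fintype A] [DecidableEq A] (n : ℕ) (Q : A → ℝ) :
    Set (Fin n → A) := {x | empDist x = Q}

/-- A permutation `π` of `{1,…,n}` acts on sequences by `(π x)_i = x_{π(i)}`. -/
def permSeq {A : Type*} {n : ℕ} (π : Equiv.Perm (Fin n)) (x : Fin n → A) : Fin n → A :=
  x ∘ π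

lemma exists_perm_of_empDist {A : Type*} [Fintype A] [DecidableEq A] {n : ℕ} (hn : 1 ≤ n)
    (x y : Fin n → A) (h : empDist x = empDist y) : ∃ σ : Equiv.Perm (Fin n), x ∘ σ = y := by
  have hn' : (n : ℝ) ≠ 0 := by positivity
  have hc : ∀ a, Nonempty ({i // y i = a} ≃ {i // x i = a}) := by
    intro a
    have := congrFun h a
    simp only [empDist] at this
    rw [div_left_inj' hn'] at this
    refine ⟨Fintype.equivOfCardEq ?_⟩
    rw [Fintype.card_subtype, Fintype.card_subtype]
    exact_mod_cast this.symm
  refine ⟨Equiv.ofFiberEquiv fun a => (hc a).some, ?_⟩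
  funext i
  exact Equiv.ofFiberEquiv_map _ i

lemma empDist_comp {A : Type*} [Fintype A] [DecidableEq A] {n : ℕ}
    (x : Fin n → A) (σ : Equiv.Perm (Fin n)) : empDist (x ∘ σ) = empDist x := by
  funext a
  simp only [empDist]
  congr 2
  exact Finset.card_bij (fun i _ => σ i) (by simp) (by simp) (fun b hb => ⟨σ.symm b, by simpa using hb⟩)

lemma fiber_count {A : Type*} [Fintype A] [DecidableEq A] {n : ℕ} (hn : 1 ≤ n)
    (T : Finset (Fin n → A)) (Q : A → ℝ) (hT : ∀ x, x ∈ T ↔ empDist x = Q)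
    (v u : Fin n → A) (hv : v ∈ T) (hu : u ∈ T) :
    T.card * (Finset.univ.filter fun π : Equiv.Perm (Fin n) => permSeq π v = u).card
      = Fintype.card (Equiv.Perm (Fin n)) := by
  have h1 : ∀ w ∈ T, (Finset.univ.filter fun π : Equiv.Perm (Fin n) => permSeq π v = w).card
      = (Finset.univ.filter fun π : Equiv.Perm (Fin n) => permSeq π v = u).card := by
    intro w hw
    obtain ⟨τ, hτ⟩ := exists_perm_of_empDist hn w u (((hT w).1 hw).trans ((hT u).1 hu).symm)
    refine Finset.card_bij (fun π _ => π * τ) ?_ ?_ ?_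
    · intro π hπ
      simp only [Finset.mem_filter, Finset.mem_univ, true_and] at hπ ⊢
      unfold permSeq at hπ ⊢
      rw [← hτ, ← hπ]
      rfl
    · intro a _ b _ hab
      exact mul_right_cancel hab
    · intro b hb
      refine ⟨b * τ⁻¹, ?_, by simp⟩
      simp only [Finset.mem_filter, Finset.mem_univ, true_and] at hb ⊢
      unfold permSeq at hb ⊢
      funext i
      have := congrFun (hb.trans hτ.symm) (τ⁻¹ i)
      simpa using this
  have h2 : Fintype.card (Equiv.Perm (Fin n)) =
      ∑ w ∈ T, (Finset.univ.filter fun π : Equiv.Perm (Fin n) => permSeq π v = w).card := by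
    rw [← Finset.card_univ]
    refine Finset.card_eq_sum_card_fiberwise ?_
    intro π _
    exact (hT _).2 ((empDist_comp v π).trans ((hT v).1 hv))
  rw [h2, Finset.sum_congr rfl h1]
  simp

lemma greedy_step {A : Type*} [Fintype A] [DecidableEq A] {n : ℕ} (hn : 1 ≤ n)
    (T D U : Finset (Fin n → A)) (Q : A → ℝ) (hT : ∀ x, x ∈ T ↔ empDist x = Q)
    (hD : D ⊆ T) (hU : U ⊆ T) :
    ∃ π : Equiv.Perm (Fin n), U.card * D.card ≤ T.card * (U ∩ D.image (permSeq π)).card := by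
  by_contra! hcon
  have hinj : ∀ π : Equiv.Perm (Fin n), Function.Injective (permSeq (A := A) π) := by
    intro π a b hab
    exact π.surjective.injective_comp_right hab
  have h1 : ∀ π : Equiv.Perm (Fin n), (U ∩ D.image (permSeq π)).card
      = ∑ u ∈ U, ∑ v ∈ D, if permSeq π v = u then 1 else 0 := by
    intro π
    rw [← Finset.filter_mem_eq_inter, Finset.card_filter]
    refine Finset.sum_congr rfl fun u _ => ?_
    by_cases hu : u ∈ D.image (permSeq π)
    · rw [if_pos hu]
      obtain ⟨v, hv, rfl⟩ := Finset.mem_image.1 hu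
      simp [(hinj π).eq_iff, hv]
    · rw [if_neg hu]
      symm
      refine Finset.sum_eq_zero fun v hv => if_neg ?_
      intro h
      exact hu (Finset.mem_image.2 ⟨v, hv, h⟩)
  have h2 : ∑ π : Equiv.Perm (Fin n), T.card * (U ∩ D.image (permSeq π)).card
      = ∑ π : Equiv.Perm (Fin n), U.card * D.card := by
    simp_rw [h1]
    rw [← Finset.mul_sum, Finset.sum_comm, Finset.mul_sum]
    have : ∀ u ∈ U, T.card * ∑ π : Equiv.Perm (Fin n), ∑ v ∈ D, (if permSeq π v = u then 1 else 0)
        = D.card * Fintype.card (Equiv.Perm (Fin n)) := by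
      intro u hu
      rw [Finset.sum_comm, Finset.mul_sum]
      rw [Finset.sum_congr rfl (g := fun _ => Fintype.card (Equiv.Perm (Fin n)))]
      · simp
      · intro v hv
        rw [← Finset.card_filter]
        exact fiber_count hn T Q hT v u (hD hv) (hU hu)
    rw [Finset.sum_congr rfl this]
    simp only [Finset.sum_const, smul_eq_mul, Finset.card_univ]
    ring
  exact absurd h2 (Finset.sum_lt_sum_of_nonempty Finset.univ_nonempty fun π _ => hcon π).ne

lemma greedy_iter {A : Type*} [Fintype A] [DecidableEq A] {n : ℕ} (hn : 1 ≤ n)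
    (T D : Finset (Fin n → A)) (Q : A → ℝ) (hT : ∀ x, x ∈ T ↔ empDist x = Q)
    (hD : D ⊆ T) (hT0 : 0 < T.card) (k : ℕ) :
    ∃ π : Fin k → Equiv.Perm (Fin n),
      ((T.filter fun u => ∀ t, u ∉ D.image (permSeq (π t))).card : ℝ)
        ≤ T.card * (1 - (D.card : ℝ) / T.card) ^ k := by
  induction k with
  | zero =>
    refine ⟨Fin.elim0, ?_⟩
    simp
  | succ k ih =>
    obtain ⟨π, hπ⟩ := ih
    set U := T.filter fun u => ∀ t, u ∉ D.image (permSeq (π t)) with hU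
    obtain ⟨ρ, hρ⟩ := greedy_step hn T D U Q hT hD (Finset.filter_subset _ _)
    refine ⟨Fin.cons ρ π, ?_⟩
    have hTr : (0 : ℝ) < T.card := by exact_mod_cast hT0
    have hle : (D.card : ℝ) ≤ T.card := by exact_mod_cast Finset.card_le_card hD
    have hset : (T.filter fun u => ∀ t, u ∉ D.image (permSeq ((Fin.cons ρ π : Fin (k+1) → Equiv.Perm (Fin n)) t)))
        = U \ D.image (permSeq ρ) := by
      ext u
      simp only [hU, Finset.mem_filter, Finset.mem_sdiff, Fin.forall_fin_succ, Fin.cons_zero,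
        Fin.cons_succ]
      tauto
    rw [hset]
    have hcard : ((U \ D.image (permSeq ρ)).card : ℝ) + (U ∩ D.image (permSeq ρ)).card = U.card := by
      exact_mod_cast Finset.card_sdiff_add_card_inter U _
    have hρ' : (U.card : ℝ) * D.card ≤ T.card * (U ∩ D.image (permSeq ρ)).card := by
      exact_mod_cast hρ
    have h3 : (U.card : ℝ) * (D.card / T.card) ≤ (U ∩ D.image (permSeq ρ)).card := by
      rw [← mul_div_assoc, div_le_iff₀ hTr]; linarith
    have hx : 0 ≤ 1 - (D.card : ℝ) / T.card := by
      rw [sub_nonneg, div_le_one hTr]; exact hle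
    calc ((U \ D.image (permSeq ρ)).card : ℝ) ≤ U.card * (1 - (D.card : ℝ) / T.card) := by linarith
      _ ≤ (T.card * (1 - (D.card : ℝ) / T.card) ^ k) * (1 - (D.card : ℝ) / T.card) := by gcongr
      _ = _ := by ring

lemma numeric (N d : ℕ) (hN : 2 ≤ N) (hd : 1 ≤ d) (hdN : d < N) (k : ℕ)
    (hk : (N : ℝ) / d * Real.logb 2 N < k + 1) :
    (N : ℝ) * (1 - (d : ℝ) / N) ^ k < 1 := by
  have hNr : (0 : ℝ) < N := by positivity
  have hdr : (0 : ℝ) < d := by positivity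
  have hl2 := Real.log_two_gt_d9
  have hl2' := Real.log_two_lt_d9
  obtain ⟨x, hx⟩ : ∃ x, x = (d : ℝ) / N := ⟨_, rfl⟩
  have hx0 : 0 < x := by rw [hx]; positivity
  have hx1 : x < 1 := by rw [hx, div_lt_one hNr]; exact_mod_cast hdN
  have hk2 : Real.log N < (k + 1) * x * Real.log 2 := by
    have e : (N : ℝ) / d * Real.logb 2 N = Real.log N / (x * Real.log 2) := by
      rw [hx, Real.logb]; field_simp
    rw [e, div_lt_iff₀ (by positivity)] at hk
    linarith
  rw [← hx]
  have hy : 0 < 1 - x := by linarith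
  have h4 : 4 ≤ N → 2 * Real.log 2 ≤ Real.log N := by
    intro h
    have : Real.log 4 ≤ Real.log N := Real.log_le_log (by norm_num) (by exact_mod_cast h)
    rw [show (4 : ℝ) = 2 ^ 2 by norm_num, Real.log_pow] at this
    exact_mod_cast this
  have h3 : 4 * Real.log 2 ≤ 3 * Real.log 3 := by
    have : Real.log ((2:ℝ) ^ 4) ≤ Real.log ((3:ℝ) ^ 3) := Real.log_le_log (by norm_num) (by norm_num)
    rw [Real.log_pow, Real.log_pow] at this
    exact_mod_cast this
  have key : Real.log N + k * Real.log (1 - x) < 0 := by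
    rcases lt_or_ge x (1/2) with hlt | hge
    · have hlog : Real.log (1 - x) ≤ -x := by
        have := Real.log_le_sub_one_of_pos hy; linarith
      have hm : x * Real.log 2 ≤ Real.log N * (1 - Real.log 2) := by
        by_cases hN4 : 4 ≤ N
        · have := h4 hN4
          nlinarith
        · have hdd : 2 * d < N := by
            rw [hx, div_lt_iff₀ hNr] at hlt
            have : (2 * d : ℝ) < N := by linarith
            exact_mod_cast this
          obtain ⟨rfl, rfl⟩ : N = 3 ∧ d = 1 := by omega
          norm_num at hx ⊢
          rw [hx]
          nlinarith
      have : (k:ℝ) * Real.log (1 - x) ≤ k * (-x) := by gcongr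
      nlinarith
    · have hlog : Real.log (1 - x) ≤ - (2 * x * Real.log 2) := by
        have h5 := Real.log_le_sub_one_of_pos (show 0 < 2 * (1 - x) by linarith)
        rw [Real.log_mul (by norm_num) hy.ne'] at h5
        nlinarith
      have hm : 2 * x * Real.log 2 ≤ Real.log N := by
        by_cases hN4 : 4 ≤ N
        · have := h4 hN4
          nlinarith
        · have hdd : N ≤ 2 * d := by
            rw [hx, le_div_iff₀ hNr] at hge
            have : (N : ℝ) ≤ 2 * d := by linarith
            exact_mod_cast this
          have : (N = 2 ∧ d = 1) ∨ (N = 3 ∧ d = 2) := by omega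
          rcases this with ⟨rfl, rfl⟩ | ⟨rfl, rfl⟩
          · norm_num at hx ⊢
            rw [hx]; linarith
          · norm_num at hx ⊢
            rw [hx]; linarith
      have : (k:ℝ) * Real.log (1 - x) ≤ k * (- (2 * x * Real.log 2)) := by gcongr
      nlinarith
  rw [← Real.log_neg_iff (by positivity), Real.log_mul hNr.ne' (by positivity), Real.log_pow]
  exact key

/-- **Covering a type class by permutations (Ahlswede's covering lemma).** For any type `Q` of
length-`n` sequences with `|T_n(Q)| ≥ 2` and any nonempty `D ⊆ T_n(Q)` there are permutations
`π_0, …, π_κ` with `κ + 1 ≤ (|T_n(Q)|/|D|) · log₂|T_n(Q)|` whose translates of `D` cover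
`T_n(Q)`. -/
theorem covering_type_class_by_permutations
    {𝓧 : Type*} [Fintype 𝓧] [DecidableEq 𝓧] {n : ℕ} (hn : 1 ≤ n)
    (Q : 𝓧 → ℝ) (hQ : ∃ x : Fin n → 𝓧, empDist x = Q)
    (hT2 : 2 ≤ (typeClass 𝓧 n Q).ncard)
    (D : Set (Fin n → 𝓧)) (hDne : D.Nonempty) (hDsub : D ⊆ typeClass 𝓧 n Q) :
    ∃ (κ : ℕ) (π : Fin (κ + 1) → Equiv.Perm (Fin n)),
      ((κ : ℝ) + 1)
          ≤ ((typeClass 𝓧 n Q).ncard : ℝ) / (D.ncard : ℝ)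
              * Real.logb 2 ((typeClass 𝓧 n Q).ncard : ℝ) ∧
      (⋃ t, permSeq (π t) '' D) = typeClass 𝓧 n Q := by
  classical
  obtain ⟨T, hTe⟩ : ∃ T : Finset (Fin n → 𝓧), (T : Set (Fin n → 𝓧)) = typeClass 𝓧 n Q :=
    ⟨(Set.toFinite _).toFinset, Set.Finite.coe_toFinset _⟩
  obtain ⟨E, rfl⟩ : ∃ E : Finset (Fin n → 𝓧), (E : Set (Fin n → 𝓧)) = D :=
    ⟨(Set.toFinite _).toFinset, Set.Finite.coe_toFinset _⟩
  have hT : ∀ x, x ∈ T ↔ empDist x = Q := by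
    intro x
    rw [← Finset.mem_coe, hTe]; rfl
  rw [← hTe] at hT2 hDsub ⊢
  rw [Set.ncard_coe_finset] at hT2 ⊢
  rw [Set.ncard_coe_finset]
  have hDT : E ⊆ T := by exact_mod_cast hDsub
  have hd : 1 ≤ E.card := Finset.card_pos.2 (by exact_mod_cast hDne)
  have hle := Finset.card_le_card hDT
  have hNr : (0 : ℝ) < T.card := by exact_mod_cast (by omega : 0 < T.card)
  have hL : 1 ≤ Real.logb 2 T.card := by
    rw [Real.le_logb_iff_rpow_le (by norm_num) hNr]
    simpa using (by exact_mod_cast hT2 : (2 : ℝ) ≤ T.card)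
  rcases hle.lt_or_eq with hlt | heq
  · obtain ⟨k, hk⟩ : ∃ k, k = ⌊(T.card : ℝ) / E.card * Real.logb 2 T.card⌋₊ := ⟨_, rfl⟩
    have hnum := numeric T.card E.card hT2 hd hlt k (by rw [hk]; exact Nat.lt_floor_add_one _)
    obtain ⟨π, hπ⟩ := greedy_iter hn T E Q hT hDT (by omega) k
    have h0 := hπ.trans_lt hnum
    have h0' : (T.filter fun u => ∀ t, u ∉ E.image (permSeq (π t))).card = 0 := by
      have : (T.filter fun u => ∀ t, u ∉ E.image (permSeq (π t))).card < 1 := by exact_mod_cast h0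
      omega
    rw [Finset.card_eq_zero, Finset.filter_eq_empty_iff] at h0'
    have hkle : (k : ℝ) ≤ (T.card : ℝ) / E.card * Real.logb 2 T.card := by
      rw [hk]; exact Nat.floor_le (by positivity)
    cases k with
    | zero =>
      have : (2 : ℝ) ≤ T.card := by exact_mod_cast hT2
      rw [pow_zero, mul_one] at hnum
      linarith
    | succ κ =>
      refine ⟨κ, π, by exact_mod_cast hkle, ?_⟩
      ext u
      simp only [Set.mem_iUnion, Set.mem_image, Finset.mem_coe]
      constructor
      · rintro ⟨t, v, hv, rfl⟩
        exact (hT _).2 ((empDist_comp v (π t)).trans ((hT v).1 (hDT hv)))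
      · intro hu
        have := h0' hu
        push Not at this
        obtain ⟨t, ht⟩ := this
        exact ⟨t, Finset.mem_image.1 ht⟩
  · have hET : E = T := Finset.eq_of_subset_of_card_le hDT heq.ge
    subst hET
    refine ⟨0, fun _ => 1, ?_, ?_⟩
    · rw [div_self hNr.ne']; simpa using hL
    · ext u
      simp [permSeq]

end
end

section
/- Single-type secure rate-distortion code: Let 𝒳, 𝒲, 𝒵 be finite alphabets, d_L : 𝒳×𝒲 → [0,∞) and d_E : 𝒳×𝒵 → [0,∞) distortion measures such that for every x ∈ 𝒳 there exist w, z with d_L(x,w) = 0 and d_E(x,z) = 0. Let Q ∈ 𝒫(𝒳) have full support on 𝒳, let δ > 0, Dc ≥ 0 and R > 0, and let n_1 < n_2 < … be the blocklengths n for which T_n(Q) is nonempty. Then there exist finite cryptogram alphabets 𝒴_{n_l}, encoders f_{n_l} : T_{n_l}(Q) × {0,1}^{⌈n_l R⌉} → 𝒴_{n_l}, and decoders φ_{n_l} : 𝒴_{n_l} × {0,1}^{⌈n_l R⌉} → 𝒲^{n_l} such that: (i) limsup_{l→∞} (1/n_l) log₂|𝒴_{n_l}| ≤ R_{d_L}(Q,Dc)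 + δ; (ii) for every l, every x ∈ T_{n_l}(Q) and every key u ∈ {0,1}^{⌈n_l R⌉}, d_L(x, φ_{n_l}(f_{n_l}(x,u),u)) ≤ Dc; and (iii) for every D ≥ Dc, liminf_{l→∞} −(1/n_l) log₂ max_{σ : 𝒴_{n_l} → 𝒵^{n_l}} P[ d_E(X, σ(f_{n_l}(X,U))) ≤ D ] ≥ min{R, R_{d_E}(Q,D)} − δ, where X is uniform on T_{n_l}(Q), U is uniform on {0,1}^{⌈n_l R⌉}, and X, U are independent. -/
open scoped BigOperators

noncomputable section

open Classical in
/-- Indicator of a proposition, as a real number. -/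
def ind (p : Prop) : ℝ := if p then 1 else 0

/-- Average per-letter distortion between sequences. -/
def seqDist {A B : Type*} (d : A → B → ℝ) {n : ℕ} (x : Fin n → A) (z : Fin n → B) : ℝ :=
  (n : ℝ)⁻¹ * ∑ i, d (x i) (z i)

/-- `p` is a probability distribution on a finite alphabet. -/
def IsDist {A : Type*} [Fintype A] (p : A → ℝ) : Prop :=
  (∀ a, 0 ≤ p a) ∧ ∑ a, p a = 1

/-- Mutual information (base 2) of a joint distribution on `A × B`. -/
def mutInfo {A B : Type*} [Fintype A] [Fintype B] (q : A × B → ℝ) : ℝ :=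
  ∑ p : A × B, q p * Real.logb 2 (q p / ((∑ b, q (p.1, b)) * (∑ a, q (a, p.2))))

/-- Rate-distortion function of `Q` under distortion `d` at level `D`. -/
def rateDist {A B : Type*} [Fintype A] [Fintype B] (d : A → B → ℝ) (Q : A → ℝ) (D : ℝ) : ℝ :=
  sInf {r | ∃ q : A × B → ℝ, IsDist q ∧ (∀ a, ∑ b, q (a, b) = Q a) ∧
    (∑ p : A × B, q p * d p.1 p.2) ≤ D ∧ r = mutInfo q}

section SecureCodeA
open Finset

/-- Number of occurrences of a letter. -/
def cnt {C : Type*} [DecidableEq C] {n : ℕ} (y : Fin n → C) (c : C) : ℕ :=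
  (univ.filter fun i => y i = c).card

lemma cnt_comp_perm {C : Type*} [DecidableEq C] {n : ℕ} (y : Fin n → C)
    (π : Equiv.Perm (Fin n)) (c : C) : cnt (y ∘ π) c = cnt y c := by
  unfold cnt
  refine Finset.card_bij (fun i _ => π i) ?_ ?_ ?_
  · intro i hi; simpa using hi
  · intro i _ j _ h; exact π.injective h
  · intro j hj; exact ⟨π.symm j, by simpa using hj, by simp⟩

lemma cnt_sum {C : Type*} [Fintype C] [DecidableEq C] {n : ℕ} (y : Fin n → C) :
    ∑ c, cnt y c = n := by
  unfold cnt
  have := Finset.card_eq_sum_card_fiberwise (f := y) (s := univ) (t := univ)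
    (fun _ _ => by simp)
  simpa using this.symm

lemma exists_perm {C : Type*} [DecidableEq C] {n : ℕ} (y y' : Fin n → C)
    (h : ∀ c, cnt y c = cnt y' c) : ∃ π : Equiv.Perm (Fin n), y ∘ π = y' := by
  have e : ∀ c, Nonempty ({i // y' i = c} ≃ {i // y i = c}) := by
    intro c
    refine ⟨Fintype.equivOfCardEq ?_⟩
    rw [Fintype.card_subtype, Fintype.card_subtype]
    exact (h c).symm
  refine ⟨Equiv.ofFiberEquiv (f := y') (g := y) (fun c => (e c).some), ?_⟩
  funext i
  exact Equiv.ofFiberEquiv_map _ i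

lemma perm_count {C : Type*} [Fintype C] [DecidableEq C] {n : ℕ} (y y' : Fin n → C)
    (h : ∀ c, cnt y c = cnt y' c) :
    (univ.filter fun π : Equiv.Perm (Fin n) => y ∘ π = y').card = ∏ c, (cnt y c).factorial := by
  obtain ⟨π₀, h₀⟩ := exists_perm y y' h
  have h1 := DomMulAct.stabilizer_card (f := y)
  have h2 : ∏ c, (cnt y c).factorial = ∏ c, (Fintype.card {a // y a = c}).factorial := by
    refine Finset.prod_congr rfl fun c _ => ?_
    rw [Fintype.card_subtype]; rfl
  rw [h2, ← h1, Fintype.card_subtype]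
  refine Finset.card_bij (fun π _ => π * π₀⁻¹) ?_ ?_ ?_
  · intro π hπ
    simp only [mem_filter, mem_univ, true_and] at hπ ⊢
    rw [Equiv.Perm.coe_mul, ← Function.comp_assoc, hπ, ← h₀]
    funext i; simp
  · intro a _ b _ hab; exact mul_right_cancel hab
  · intro π hπ
    simp only [mem_filter, mem_univ, true_and] at hπ
    refine ⟨π * π₀, ?_, by simp⟩
    simp only [mem_filter, mem_univ, true_and]
    rw [Equiv.Perm.coe_mul, ← Function.comp_assoc, hπ, h₀]

/-- conditional type class size -/
lemma class_count {A B : Type*} [Fintype A] [DecidableEq A] [Fintype B] [DecidableEq B] {n : ℕ}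
    (x : Fin n → A) (w : Fin n → B) :
    (univ.filter fun x' : Fin n → A => ∀ c, cnt (fun i => (x' i, w i)) c
        = cnt (fun i => (x i, w i)) c).card * ∏ c, (cnt (fun i => (x i, w i)) c).factorial
      = ∏ b, (cnt w b).factorial := by
  rw [← perm_count w w (fun _ => rfl)]
  rw [Finset.card_eq_sum_card_fiberwise (f := fun π : Equiv.Perm (Fin n) => x ∘ π)
    (t := univ.filter fun x' : Fin n → A => ∀ c, cnt (fun i => (x' i, w i)) c
        = cnt (fun i => (x i, w i)) c)]
  · rw [Finset.sum_congr rfl (g := fun _ => ∏ c, (cnt (fun i => (x i, w i)) c).factorial)]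
    · simp
    · intro x' hx'
      simp only [mem_filter, mem_univ, true_and] at hx'
      rw [← perm_count _ _ (fun c => (hx' c).symm)]
      congr 1
      ext π
      simp only [mem_filter, mem_univ, true_and, funext_iff, Function.comp, Prod.mk.injEq]
      constructor
      · rintro ⟨h1, h2⟩ i; exact ⟨h2 i, h1 i⟩
      · intro h; exact ⟨fun i => (h i).2, fun i => (h i).1⟩
  · intro π hπ
    simp only [coe_filter, mem_univ, true_and, Set.mem_ofPred_eq] at hπ ⊢
    intro c
    have : (fun i => ((x ∘ π) i, w i)) = (fun i => (x i, w i)) ∘ π := by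
      funext i
      have := congrFun hπ i
      simp only [Function.comp] at this ⊢
      rw [this]
    rw [this, cnt_comp_perm]

/-- The type class as a finset, by counts of a reference sequence -/
def TC {A : Type*} [Fintype A] [DecidableEq A] {n : ℕ} (x : Fin n → A) : Finset (Fin n → A) :=
  univ.filter fun x' => ∀ a, cnt x' a = cnt x a

lemma mem_TC {A : Type*} [Fintype A] [DecidableEq A] {n : ℕ} {x x' : Fin n → A} :
    x' ∈ TC x ↔ ∀ a, cnt x' a = cnt x a := by simp [TC]

lemma TC_count {A : Type*} [Fintype A] [DecidableEq A] {n : ℕ} (x : Fin n → A) :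
    (TC x).card * ∏ a, (cnt x a).factorial = n.factorial := by
  have h : (univ : Finset (Equiv.Perm (Fin n))).card = n.factorial := by
    rw [Finset.card_univ, Fintype.card_perm, Fintype.card_fin]
  rw [← h, Finset.card_eq_sum_card_fiberwise (f := fun π : Equiv.Perm (Fin n) => x ∘ π)
    (t := TC x)]
  · rw [Finset.sum_congr rfl (g := fun _ => ∏ c, (cnt x c).factorial)]
    · simp
    · intro x' hx'
      rw [← perm_count _ _ (fun c => (mem_TC.1 hx' c).symm)]
  · intro π _
    exact mem_TC.2 fun a => cnt_comp_perm _ _ _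

lemma TC_pos {A : Type*} [Fintype A] [DecidableEq A] {n : ℕ} (x : Fin n → A) :
    0 < (TC x).card := Finset.card_pos.2 ⟨x, mem_TC.2 fun _ => rfl⟩

lemma perm_hit {A : Type*} [Fintype A] [DecidableEq A] {n : ℕ} (x : Fin n → A)
    (S : Finset (Fin n → A)) (hS : S ⊆ TC x) (y : Fin n → A) (hy : y ∈ TC x) :
    (univ.filter fun π : Equiv.Perm (Fin n) => y ∘ π ∈ S).card * (TC x).card
      = S.card * Fintype.card (Equiv.Perm (Fin n)) := by
  have h : (univ.filter fun π : Equiv.Perm (Fin n) => y ∘ π ∈ S).card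
      = S.card * ∏ a, (cnt x a).factorial := by
    rw [Finset.card_eq_sum_card_fiberwise (f := fun π : Equiv.Perm (Fin n) => y ∘ π) (t := S)]
    · rw [Finset.sum_congr rfl (g := fun _ => ∏ c, (cnt x c).factorial)]
      · simp
      · intro x' hx'
        have h1 : ∏ c, (cnt x c).factorial = ∏ c, (cnt y c).factorial :=
          Finset.prod_congr rfl fun c _ => by rw [mem_TC.1 hy]
        rw [h1, ← perm_count y x' fun c => by rw [mem_TC.1 hy, mem_TC.1 (hS hx')]]
        congr 1
        ext π
        simp only [mem_filter, mem_univ, true_and]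
        constructor
        · exact fun h => h.2
        · intro h; exact ⟨h ▸ hx', h⟩
    · intro π hπ; simpa using hπ
  rw [h, Fintype.card_perm, Fintype.card_fin, ← TC_count x]; ring

end SecureCodeA

section SecureCodeB
open Finset

lemma exp_le_chord (y : ℝ) (h0 : 0 ≤ y) (h1 : y ≤ 1) : Real.exp y ≤ 1 + 2 * y := by
  have hc := convexOn_exp.2 (Set.mem_univ (0 : ℝ)) (Set.mem_univ (1 : ℝ))
    (sub_nonneg.2 h1) h0 (by ring)
  simp only [smul_eq_mul, mul_zero, mul_one, zero_add, Real.exp_zero] at hc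
  have := Real.exp_one_lt_d9
  nlinarith

lemma chernoff {S I U : Type*} [Fintype S] [Nonempty S] [Fintype I] [Nonempty I] [Fintype U]
    [DecidableEq U]
    (Y : I → S → ℝ) (p : I → ℝ) (h0 : ∀ i s, 0 ≤ Y i s) (h1 : ∀ i s, Y i s ≤ 1)
    (hm : ∀ i, ∑ s, Y i s ≤ p i * Fintype.card S) :
    ∃ π : U → S, ∀ i, ∑ u, Y i (π u) ≤ 2 * Fintype.card U * p i
      + Real.log (Fintype.card I) := by
  have hSpos : (0 : ℝ) < Fintype.card S := by exact_mod_cast Fintype.card_pos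
  have hIpos : (0 : ℝ) < Fintype.card I := by exact_mod_cast Fintype.card_pos
  have hmgf : ∀ i, ∑ s, Real.exp (Y i s) ≤ Fintype.card S * Real.exp (2 * p i) := by
    intro i
    calc ∑ s, Real.exp (Y i s) ≤ ∑ s, (1 + 2 * Y i s) :=
          Finset.sum_le_sum fun s _ => exp_le_chord _ (h0 i s) (h1 i s)
      _ = Fintype.card S + 2 * ∑ s, Y i s := by
          rw [Finset.sum_add_distrib, ← Finset.mul_sum]; simp
      _ ≤ Fintype.card S * (2 * p i + 1) := by nlinarith [hm i]
      _ ≤ _ := by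
          apply mul_le_mul_of_nonneg_left (Real.add_one_le_exp _) hSpos.le
  have hi : ∀ i, ∑ π : U → S, Real.exp (∑ u, Y i (π u) - 2 * Fintype.card U * p i)
      ≤ (Fintype.card S : ℝ) ^ (Fintype.card U) := by
    intro i
    have e1 : ∀ π : U → S, Real.exp (∑ u, Y i (π u) - 2 * Fintype.card U * p i)
        = (∏ u, Real.exp (Y i (π u))) * Real.exp (-(2 * Fintype.card U * p i)) := by
      intro π
      rw [← Real.exp_sum, ← Real.exp_add, sub_eq_add_neg]
    simp_rw [e1]
    rw [← Finset.sum_mul]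
    have e2 : ∑ π : U → S, ∏ u, Real.exp (Y i (π u)) = ∏ _u : U, ∑ s, Real.exp (Y i s) := by
      rw [Finset.prod_univ_sum]
      simp
    rw [e2, Finset.prod_const, Finset.card_univ]
    calc (∑ s, Real.exp (Y i s)) ^ Fintype.card U * Real.exp (-(2 * Fintype.card U * p i))
        ≤ (Fintype.card S * Real.exp (2 * p i)) ^ Fintype.card U
            * Real.exp (-(2 * Fintype.card U * p i)) := by
          gcongr
          exact hmgf i
      _ = (Fintype.card S : ℝ) ^ (Fintype.card U) := by
          rw [mul_pow, ← Real.exp_nat_mul, mul_assoc, ← Real.exp_add]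
          have : (Fintype.card U : ℝ) * (2 * p i) + -(2 * Fintype.card U * p i) = 0 := by ring
          rw [this, Real.exp_zero, mul_one]
  have hex : ∃ π ∈ (univ : Finset (U → S)),
      ∑ i, Real.exp (∑ u, Y i (π u) - 2 * Fintype.card U * p i) ≤ Fintype.card I := by
    apply Finset.exists_le_of_sum_le (univ_nonempty)
    rw [Finset.sum_comm]
    calc _ ≤ ∑ i : I, (Fintype.card S : ℝ) ^ (Fintype.card U) :=
          Finset.sum_le_sum fun i _ => hi i
      _ = _ := by
          simp [mul_comm]
  obtain ⟨π, -, hπ⟩ := hex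
  refine ⟨π, fun i => ?_⟩
  have h2 : Real.exp (∑ u, Y i (π u) - 2 * Fintype.card U * p i) ≤ Fintype.card I :=
    (Finset.single_le_sum (f := fun i => Real.exp (∑ u, Y i (π u) - 2 * Fintype.card U * p i))
      (fun _ _ => (Real.exp_pos _).le) (mem_univ i)).trans hπ
  have h3 := (Real.le_log_iff_exp_le hIpos).2 h2
  linarith

/-- Covering the type class by permuted copies of a subset. -/
lemma cover_step {A : Type*} [Fintype A] [DecidableEq A] {n : ℕ} (x : Fin n → A)
    (S : Finset (Fin n → A)) (hS : S ⊆ TC x) (M : ℕ) :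
    ∃ τ : Fin M → Equiv.Perm (Fin n),
      (((TC x).filter fun y => ∀ j, y ∘ τ j ∉ S).card : ℝ)
        ≤ (1 - S.card / (TC x).card) ^ M * (TC x).card := by
  induction M with
  | zero => exact ⟨fun j => j.elim0, by simp⟩
  | succ M ih =>
    obtain ⟨τ, hτ⟩ := ih
    set V := (TC x).filter fun y => ∀ j, y ∘ τ j ∉ S with hV
    have hT : (0 : ℝ) < (TC x).card := by exact_mod_cast TC_pos x
    have hα : (S.card : ℝ) / (TC x).card ≤ 1 := by
      rw [div_le_one hT]; exact_mod_cast Finset.card_le_card hS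
    have havg : ∃ π ∈ (univ : Finset (Equiv.Perm (Fin n))),
        ((V.filter fun y => y ∘ π ∉ S).card : ℝ) ≤ (1 - S.card / (TC x).card) * V.card := by
      apply Finset.exists_le_of_sum_le univ_nonempty
      have e1 : ∀ π : Equiv.Perm (Fin n), ((V.filter fun y => y ∘ π ∉ S).card : ℝ)
          = ∑ y ∈ V, (1 - if y ∘ π ∈ S then (1 : ℝ) else 0) := by
        intro π
        rw [Finset.card_filter]
        push_cast
        refine Finset.sum_congr rfl fun y _ => ?_
        by_cases h : y ∘ π ∈ S <;> simp [h]
      simp_rw [e1]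
      rw [Finset.sum_comm]
      have e2 : ∀ y ∈ V, ∑ π : Equiv.Perm (Fin n), (1 - if y ∘ π ∈ S then (1 : ℝ) else 0)
          = (1 - S.card / (TC x).card) * Fintype.card (Equiv.Perm (Fin n)) := by
        intro y hy
        have := perm_hit x S hS y (Finset.mem_filter.1 hy).1
        rw [Finset.sum_sub_distrib, ← Finset.sum_filter]
        simp only [sum_const, card_univ, nsmul_eq_mul, mul_one]
        have h' : ((univ.filter fun π : Equiv.Perm (Fin n) => y ∘ π ∈ S).card : ℝ) * (TC x).card
          = S.card * Fintype.card (Equiv.Perm (Fin n)) := by exact_mod_cast this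
        have h'' : ((univ.filter fun π : Equiv.Perm (Fin n) => y ∘ π ∈ S).card : ℝ)
            = S.card * Fintype.card (Equiv.Perm (Fin n)) / (TC x).card := by
          rw [eq_div_iff hT.ne', h']
        rw [h'']; ring
      rw [Finset.sum_congr rfl e2]
      simp only [sum_const, card_univ, nsmul_eq_mul]
      apply le_of_eq; ring
    obtain ⟨π, -, hπ⟩ := havg
    refine ⟨Fin.cons π τ, ?_⟩
    have e : ((TC x).filter fun y => ∀ j, y ∘ (Fin.cons π τ : Fin (M+1) → Equiv.Perm (Fin n)) j ∉ S)
        = V.filter fun y => y ∘ π ∉ S := by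
      ext y
      simp only [hV, mem_filter, Fin.forall_fin_succ, Fin.cons_zero, Fin.cons_succ]
      tauto
    rw [e]
    refine hπ.trans ?_
    rw [pow_succ]
    have := mul_le_mul_of_nonneg_left hτ (sub_nonneg.2 hα)
    linarith

lemma cover_exists {A : Type*} [Fintype A] [DecidableEq A] {n : ℕ} (x : Fin n → A)
    (S : Finset (Fin n → A)) (hS : S ⊆ TC x) (hne : S.Nonempty) :
    ∃ (M : ℕ) (τ : Fin M → Equiv.Perm (Fin n)),
      0 < M ∧ (M : ℝ) ≤ (TC x).card / S.card * (Real.log (TC x).card + 1) ∧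
      ∀ y ∈ TC x, ∃ j, y ∘ τ j ∈ S := by
  have hT : (0 : ℝ) < (TC x).card := by exact_mod_cast TC_pos x
  have hSp : (0 : ℝ) < S.card := by exact_mod_cast Finset.card_pos.2 hne
  have hST : (S.card : ℝ) ≤ (TC x).card := by exact_mod_cast Finset.card_le_card hS
  have hα : (S.card : ℝ) / (TC x).card ≤ 1 := by rwa [div_le_one hT]
  have hlog : 0 ≤ Real.log (TC x).card := Real.log_nonneg (by exact_mod_cast TC_pos x)
  have hr : 1 ≤ ((TC x).card : ℝ) / S.card := by rwa [one_le_div hSp]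
  set r := ((TC x).card : ℝ) / S.card * Real.log (TC x).card with hrdef
  have hr0 : 0 ≤ r := by positivity
  obtain ⟨τ, hτ⟩ := cover_step x S hS (⌊r⌋₊ + 1)
  refine ⟨⌊r⌋₊ + 1, τ, by omega, ?_, ?_⟩
  · push_cast
    have := Nat.floor_le hr0
    rw [mul_add, mul_one]; linarith
  · have hlt : (1 - (S.card : ℝ) / (TC x).card) ^ (⌊r⌋₊ + 1) * (TC x).card < 1 := by
      have h1 : (1 - (S.card : ℝ) / (TC x).card) ^ (⌊r⌋₊ + 1)
          ≤ Real.exp (-((S.card : ℝ) / (TC x).card)) ^ (⌊r⌋₊ + 1) := by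
        apply pow_le_pow_left₀ (sub_nonneg.2 hα)
        have := Real.add_one_le_exp (-((S.card : ℝ) / (TC x).card))
        linarith
      rw [← Real.exp_nat_mul] at h1
      have h2 : ((⌊r⌋₊ + 1 : ℕ) : ℝ) * -((S.card : ℝ) / (TC x).card)
          < - Real.log (TC x).card := by
        have h3 : r < ((⌊r⌋₊ + 1 : ℕ) : ℝ) := by push_cast; exact Nat.lt_floor_add_one r
        have h4 : 0 < (S.card : ℝ) / (TC x).card := by positivity
        have h5 : r * ((S.card : ℝ) / (TC x).card) = Real.log (TC x).card := by
          rw [hrdef]; field_simp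
        nlinarith
      calc _ ≤ Real.exp (((⌊r⌋₊ + 1 : ℕ) : ℝ) * -((S.card : ℝ) / (TC x).card)) * (TC x).card := by
            gcongr
        _ < Real.exp (- Real.log (TC x).card) * (TC x).card := by
            gcongr
        _ = 1 := by
            rw [Real.exp_neg, Real.exp_log hT]; field_simp
    have h0 : ((TC x).filter fun y => ∀ j, y ∘ τ j ∉ S).card = 0 := by
      have := hτ.trans_lt hlt
      have h1 : ((TC x).filter fun y => ∀ j, y ∘ τ j ∉ S).card < 1 := by exact_mod_cast this
      omega
    intro y hy
    by_contra hcon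
    push Not at hcon
    have : y ∈ (TC x).filter fun y => ∀ j, y ∘ τ j ∉ S := Finset.mem_filter.2 ⟨hy, hcon⟩
    rw [Finset.card_eq_zero.1 h0] at this
    simp at this

end SecureCodeB

section SecureCodeC
open Finset

lemma seqDist_perm {A B : Type*} (d : A → B → ℝ) {n : ℕ} (x : Fin n → A) (z : Fin n → B)
    (π : Equiv.Perm (Fin n)) : seqDist d (x ∘ π) (z ∘ π) = seqDist d x z := by
  unfold seqDist
  congr 1
  exact Equiv.sum_comp π (fun i => d (x i) (z i))

lemma comp_mem_TC {A : Type*} [Fintype A] [DecidableEq A] {n : ℕ} {x y : Fin n → A}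
    (π : Equiv.Perm (Fin n)) (hy : y ∈ TC x) : y ∘ π ∈ TC x :=
  mem_TC.2 fun a => by rw [cnt_comp_perm, mem_TC.1 hy]

open Classical in
lemma secure_perms {A Z : Type*} [Fintype A] [DecidableEq A] [Fintype Z] [Nonempty Z]
    {n k M : ℕ} (x₀ : Fin n → A) (dE : A → Z → ℝ) (g : (Fin n → A) → Fin M) :
    ∃ π : (Fin k → Bool) → Equiv.Perm (Fin n),
      ∀ (D β : ℝ), (∀ z, (((TC x₀).filter fun x => seqDist dE x z ≤ D).card : ℝ)
          ≤ β * (TC x₀).card) →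
        ∀ σ : Fin M → (Fin n → Z),
          ∑ y ∈ TC x₀, ∑ u, ind (seqDist dE (y ∘ π u) (σ (g y)) ≤ D)
            ≤ (TC x₀).card * (2 * 2 ^ k * β + Real.log
              ((Fintype.card A : ℝ) ^ n * Fintype.card A ^ n * Fintype.card Z ^ n)) := by
  have hT : (0 : ℝ) < (TC x₀).card := by exact_mod_cast TC_pos x₀
  let I := ((Fin n → A) × (Fin n → A)) × (Fin n → Z)
  have : Nonempty (Fin n → A) := ⟨x₀⟩
  let C : I → Finset (Fin n → A) := fun i => (TC x₀).filter fun y => g y = g i.1.1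
  let B : I → Finset (Fin n → A) := fun i =>
    (TC x₀).filter fun y => seqDist dE y i.2 ≤ seqDist dE i.1.2 i.2
  let Y : I → Equiv.Perm (Fin n) → ℝ := fun i π =>
    (((C i).filter fun y => y ∘ π ∈ B i).card : ℝ) / (C i).card
  have hmean : ∀ i, ∑ π, Y i π ≤ ((B i).card : ℝ) / (TC x₀).card
      * Fintype.card (Equiv.Perm (Fin n)) := by
    intro i
    have e1 : ∑ π, Y i π = (∑ y ∈ C i, ∑ π : Equiv.Perm (Fin n),
        if y ∘ π ∈ B i then (1 : ℝ) else 0) / (C i).card := by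
      rw [Finset.sum_comm, Finset.sum_div]
      refine Finset.sum_congr rfl fun π _ => ?_
      simp only [Y]
      rw [Finset.card_filter]; push_cast; rfl
    have e2 : ∀ y ∈ C i, ∑ π : Equiv.Perm (Fin n), (if y ∘ π ∈ B i then (1 : ℝ) else 0)
        = ((B i).card : ℝ) / (TC x₀).card * Fintype.card (Equiv.Perm (Fin n)) := by
      intro y hy
      have := perm_hit x₀ (B i) (Finset.filter_subset _ _) y (Finset.mem_filter.1 hy).1
      have h' : ((univ.filter fun π : Equiv.Perm (Fin n) => y ∘ π ∈ B i).card : ℝ) * (TC x₀).card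
          = (B i).card * Fintype.card (Equiv.Perm (Fin n)) := by exact_mod_cast this
      rw [← Finset.sum_filter]
      simp only [sum_const, nsmul_eq_mul, mul_one]
      rw [div_mul_eq_mul_div, eq_div_iff hT.ne', h']
    rw [e1, Finset.sum_congr rfl e2, Finset.sum_const, nsmul_eq_mul]
    rcases Nat.eq_zero_or_pos (C i).card with h | h
    · rw [h]; simp; positivity
    · have : ((C i).card : ℝ) ≠ 0 := by exact_mod_cast h.ne'
      rw [mul_div_cancel_left₀ _ this]
  obtain ⟨π, hπ⟩ := chernoff (U := Fin k → Bool) Y (fun i => ((B i).card : ℝ) / (TC x₀).card)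
    (fun i π => by simp only [Y]; positivity)
    (fun i π => div_le_one_of_le₀ (by exact_mod_cast Finset.card_filter_le _ _) (by positivity))
    hmean
  have hI : (Fintype.card I : ℝ)
      = (Fintype.card A : ℝ) ^ n * Fintype.card A ^ n * Fintype.card Z ^ n := by
    simp [I]
  have hU : (Fintype.card (Fin k → Bool) : ℝ) = 2 ^ k := by simp
  rw [hI, hU] at hπ
  refine ⟨π, fun D β hβ σ => ?_⟩
  set ℓ := Real.log ((Fintype.card A : ℝ) ^ n * Fintype.card A ^ n * Fintype.card Z ^ n) with hℓ
  have hℓ0 : 0 ≤ ℓ := by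
    rw [hℓ, ← hI]; exact Real.log_natCast_nonneg _
  have hβ0 : 0 ≤ β := by
    have h := hβ (fun _ => Classical.arbitrary Z)
    by_contra hneg
    push Not at hneg
    have : β * (TC x₀).card < 0 := mul_neg_of_neg_of_pos hneg hT
    have h2 : (0 : ℝ) ≤ (((TC x₀).filter fun x =>
      seqDist dE x (fun _ => Classical.arbitrary Z) ≤ D).card : ℝ) := by positivity
    linarith
  have hj : ∀ j : Fin M, ∑ y ∈ (TC x₀).filter (fun y => g y = j),
      ∑ u, ind (seqDist dE (y ∘ π u) (σ (g y)) ≤ D)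
        ≤ ((TC x₀).filter (fun y => g y = j)).card * (2 * 2 ^ k * β + ℓ) := by
    intro j
    have hnn : 0 ≤ (((TC x₀).filter (fun y => g y = j)).card : ℝ) * (2 * 2 ^ k * β + ℓ) := by
      positivity
    rcases ((TC x₀).filter (fun y => g y = j)).eq_empty_or_nonempty with hC | ⟨y₁, hy₁⟩
    · rw [hC]; simp
    rcases ((TC x₀).filter fun x => seqDist dE x (σ j) ≤ D).eq_empty_or_nonempty with hB | hB
    · refine le_trans (le_of_eq ?_) hnn
      refine Finset.sum_eq_zero fun y hy => Finset.sum_eq_zero fun u _ => ?_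
      obtain ⟨hy1, hy2⟩ := Finset.mem_filter.1 hy
      unfold ind
      rw [if_neg]
      intro hcon
      have : y ∘ π u ∈ (TC x₀).filter fun x => seqDist dE x (σ j) ≤ D :=
        Finset.mem_filter.2 ⟨comp_mem_TC _ hy1, by rw [← hy2]; exact hcon⟩
      rw [hB] at this; simp at this
    · obtain ⟨x₁, hx₁, hmax⟩ := Finset.exists_max_image _ (fun x => seqDist dE x (σ j)) hB
      let i : I := ((y₁, x₁), σ j)
      have hBi : B i = (TC x₀).filter fun x => seqDist dE x (σ j) ≤ D := by
        ext y
        simp only [B, i, mem_filter]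
        constructor
        · rintro ⟨h1, h2⟩; exact ⟨h1, h2.trans (Finset.mem_filter.1 hx₁).2⟩
        · rintro ⟨h1, h2⟩; exact ⟨h1, hmax y (Finset.mem_filter.2 ⟨h1, h2⟩)⟩
      have hCi : C i = (TC x₀).filter (fun y => g y = j) := by
        simp only [C, i]; rw [(Finset.mem_filter.1 hy₁).2]
      have hCpos : (0 : ℝ) < (C i).card := by
        rw [hCi]; exact_mod_cast Finset.card_pos.2 ⟨y₁, hy₁⟩
      have h1 := hπ i
      have h2 : ((B i).card : ℝ) / (TC x₀).card ≤ β := by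
        rw [div_le_iff₀ hT, hBi]; exact hβ (σ j)
      have h3 : ∑ u, Y i (π u) ≤ 2 * 2 ^ k * β + ℓ := by
        refine h1.trans ?_
        gcongr
      rw [← hCi]
      calc ∑ y ∈ C i, ∑ u, ind (seqDist dE (y ∘ π u) (σ (g y)) ≤ D)
          = (C i).card * ∑ u, Y i (π u) := by
            rw [Finset.sum_comm, Finset.mul_sum]
            refine Finset.sum_congr rfl fun u _ => ?_
            simp only [Y]
            rw [mul_div_cancel₀ _ hCpos.ne', Finset.card_filter]
            push_cast
            refine Finset.sum_congr rfl fun y hy => ?_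
            rw [hCi] at hy
            obtain ⟨hy1, hy2⟩ := Finset.mem_filter.1 hy
            unfold ind
            congr 1
            rw [hBi, Finset.mem_filter, hy2]
            simp [comp_mem_TC (π u) hy1]
        _ ≤ _ := by gcongr
  rw [← Finset.sum_fiberwise (TC x₀) g]
  refine (Finset.sum_le_sum fun j _ => hj j).trans (le_of_eq ?_)
  rw [← Finset.sum_mul]
  congr 1
  rw [← Nat.cast_sum]
  congr 1
  exact (Finset.card_eq_sum_card_fiberwise (fun _ _ => by simp)).symm

open Classical in
lemma code_exists {A W Z : Type*} [Fintype A] [DecidableEq A] [Fintype Z] [Nonempty Z]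
    {n : ℕ} (k : ℕ) (x₀ : Fin n → A) (dL : A → W → ℝ) (dE : A → Z → ℝ) (Dc : ℝ) (w₀ : Fin n → W)
    (hne : ((TC x₀).filter fun y => seqDist dL y w₀ ≤ Dc).Nonempty) :
    ∃ (M : ℕ) (f : (Fin n → A) → (Fin k → Bool) → Fin M)
      (φ : Fin M → (Fin k → Bool) → (Fin n → W)),
      0 < M ∧
      (M : ℝ) ≤ (TC x₀).card / ((TC x₀).filter fun y => seqDist dL y w₀ ≤ Dc).card
        * (Real.log (TC x₀).card + 1) ∧
      (∀ x ∈ TC x₀, ∀ u, seqDist dL x (φ (f x u) u) ≤ Dc) ∧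
      ∀ (D β : ℝ), (∀ z, (((TC x₀).filter fun x => seqDist dE x z ≤ D).card : ℝ)
          ≤ β * (TC x₀).card) →
        ∀ σ : Fin M → (Fin n → Z),
          (((TC x₀).card : ℝ) * 2 ^ k)⁻¹ *
            ∑ x : Fin n → A, ∑ u, ind (x ∈ TC x₀ ∧ seqDist dE x (σ (f x u)) ≤ D)
            ≤ 2 * β + Real.log
              ((Fintype.card A : ℝ) ^ n * Fintype.card A ^ n * Fintype.card Z ^ n) / 2 ^ k := by
  obtain ⟨M, τ, hM, hMle, hcov⟩ := cover_exists x₀ _ (Finset.filter_subset _ _) hne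
  let g : (Fin n → A) → Fin M := fun y =>
    if h : ∃ j, y ∘ τ j ∈ (TC x₀).filter fun y => seqDist dL y w₀ ≤ Dc then h.choose else ⟨0, hM⟩
  have hg : ∀ y ∈ TC x₀, seqDist dL (y ∘ τ (g y)) w₀ ≤ Dc := by
    intro y hy
    have h := hcov y hy
    have : g y = h.choose := by simp only [g]; rw [dif_pos h]
    rw [this]
    exact (Finset.mem_filter.1 h.choose_spec).2
  obtain ⟨π, hπ⟩ := secure_perms (k := k) x₀ dE g
  refine ⟨M, fun x u => g (x ∘ (π u).symm), fun j u => w₀ ∘ (τ j).symm ∘ π u, hM, hMle, ?_, ?_⟩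
  · intro x hx u
    have h := hg _ (comp_mem_TC (π u).symm hx)
    rw [← seqDist_perm dL _ _ (τ (g (x ∘ (π u).symm))).symm, ← seqDist_perm dL _ _ (π u)] at h
    convert h using 2
    · funext i; simp
    · rfl
  · intro D β hβ σ
    have hT : (0 : ℝ) < (TC x₀).card := by exact_mod_cast TC_pos x₀
    have key := hπ D β hβ σ
    have e : ∑ x : Fin n → A, ∑ u, ind (x ∈ TC x₀ ∧ seqDist dE x (σ (g (x ∘ (π u).symm))) ≤ D)
        = ∑ y ∈ TC x₀, ∑ u, ind (seqDist dE (y ∘ π u) (σ (g y)) ≤ D) := by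
      rw [Finset.sum_comm, Finset.sum_comm (s := TC x₀)]
      refine Finset.sum_congr rfl fun u _ => ?_
      rw [← Finset.sum_filter_add_sum_filter_not univ (fun x => x ∈ TC x₀)]
      rw [Finset.sum_eq_zero (s := univ.filter fun x => x ∉ TC x₀), add_zero]
      · symm
        refine Finset.sum_bij (fun y _ => y ∘ π u) ?_ ?_ ?_ ?_
        · intro y hy; simpa using comp_mem_TC (π u) hy
        · intro y _ y' _ h
          funext i
          have := congrFun h ((π u).symm i)
          simpa using this
        · intro x hx
          refine ⟨x ∘ (π u).symm, comp_mem_TC _ (by simpa using hx), ?_⟩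
          funext i; simp
        · intro y hy
          have h1 : (y ∘ π u) ∘ (π u).symm = y := by funext i; simp
          rw [h1]
          simp [comp_mem_TC (π u) hy]
      · intro x hx
        unfold ind
        rw [if_neg]
        simp only [mem_filter, mem_univ, true_and] at hx
        exact fun h => hx h.1
    rw [e]
    have hpos : (0 : ℝ) < 2 ^ k := by positivity
    rw [inv_mul_le_iff₀ (by positivity)]
    refine key.trans (le_of_eq ?_)
    field_simp

end SecureCodeC

section SecureCodeD
open Finset

lemma log_fact_lower (k : ℕ) : (k : ℝ) * Real.log k - k ≤ Real.log k.factorial := by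
  induction k with
  | zero => simp
  | succ k ih =>
    rw [Nat.factorial_succ]
    have hk : (0 : ℝ) < (k : ℝ) + 1 := by positivity
    have hf : (0 : ℝ) < k.factorial := by exact_mod_cast k.factorial_pos
    push_cast
    rw [Real.log_mul hk.ne' hf.ne']
    rcases Nat.eq_zero_or_pos k with rfl | h
    · simp
    · have hk0 : (0 : ℝ) < k := by exact_mod_cast h
      have h1 : Real.log (((k : ℝ) + 1) / k) ≤ ((k : ℝ) + 1) / k - 1 :=
        Real.log_le_sub_one_of_pos (by positivity)
      rw [Real.log_div hk.ne' hk0.ne'] at h1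
      have h2 : (k : ℝ) * (((k : ℝ) + 1) / k - 1) = 1 := by field_simp; ring
      have h3 := mul_le_mul_of_nonneg_left h1 hk0.le
      rw [h2] at h3
      linarith

lemma log_fact_upper (k : ℕ) :
    Real.log k.factorial ≤ (k : ℝ) * Real.log k - k + (1 + Real.log k) := by
  rcases Nat.eq_zero_or_pos k with rfl | h
  · simp
  · induction k, h using Nat.le_induction with
    | base => simp
    | succ k h ih =>
      rw [Nat.factorial_succ]
      have hk : (0 : ℝ) < (k : ℝ) + 1 := by positivity
      have hf : (0 : ℝ) < k.factorial := by exact_mod_cast k.factorial_pos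
      push_cast
      rw [Real.log_mul hk.ne' hf.ne']
      have hk0 : (0 : ℝ) < k := by exact_mod_cast h
      have h1 : Real.log ((k : ℝ) / (k + 1)) ≤ (k : ℝ) / (k + 1) - 1 :=
        Real.log_le_sub_one_of_pos (by positivity)
      rw [Real.log_div hk0.ne' hk.ne'] at h1
      have h2 : ((k : ℝ) + 1) * ((k : ℝ) / (k + 1) - 1) = -1 := by field_simp; ring
      have h3 := mul_le_mul_of_nonneg_left h1 hk.le
      rw [h2] at h3
      linarith

lemma mutInfo_eq {A B : Type*} [Fintype A] [Fintype B] (q : A × B → ℝ) (hq : ∀ p, 0 ≤ q p) :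
    mutInfo q * Real.log 2 = ∑ p, q p * Real.log (q p)
      - ∑ a, (∑ b, q (a, b)) * Real.log (∑ b, q (a, b))
      - ∑ b, (∑ a, q (a, b)) * Real.log (∑ a, q (a, b)) := by
  have hl2 : Real.log 2 ≠ 0 := (Real.log_pos (by norm_num)).ne'
  have e1 : ∑ a, (∑ b, q (a, b)) * Real.log (∑ b, q (a, b))
      = ∑ p : A × B, q p * Real.log (∑ b, q (p.1, b)) := by
    rw [Fintype.sum_prod_type]
    exact Finset.sum_congr rfl fun a _ => by rw [Finset.sum_mul]
  have e2 : ∑ b, (∑ a, q (a, b)) * Real.log (∑ a, q (a, b))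
      = ∑ p : A × B, q p * Real.log (∑ a, q (a, p.2)) := by
    rw [Fintype.sum_prod_type_right]
    exact Finset.sum_congr rfl fun a _ => by rw [Finset.sum_mul]
  rw [e1, e2, mutInfo, Finset.sum_mul, ← Finset.sum_sub_distrib, ← Finset.sum_sub_distrib]
  refine Finset.sum_congr rfl fun p _ => ?_
  rcases (hq p).eq_or_lt with h | h
  · rw [← h]; simp
  · have ha : 0 < ∑ b, q (p.1, b) := lt_of_lt_of_le h
      (Finset.single_le_sum (f := fun b => q (p.1, b)) (fun b _ => hq _) (mem_univ p.2))
    have hb : 0 < ∑ a, q (a, p.2) := lt_of_lt_of_le h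
      (Finset.single_le_sum (f := fun a => q (a, p.2)) (fun b _ => hq _) (mem_univ p.1))
    rw [Real.logb, Real.log_div h.ne' (by positivity), Real.log_mul ha.ne' hb.ne']
    field_simp
    ring

lemma cnt_le {C : Type*} [DecidableEq C] {n : ℕ} (y : Fin n → C) (c : C) : cnt y c ≤ n := by
  unfold cnt
  simpa using Finset.card_filter_le (univ : Finset (Fin n)) (fun i => y i = c)

lemma sum_log_fact {C : Type*} [Fintype C] [DecidableEq C] {n : ℕ} (y : Fin n → C) :
    (∑ c, (cnt y c : ℝ) * Real.log (cnt y c)) - n ≤ ∑ c, Real.log (cnt y c).factorial ∧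
    ∑ c, Real.log (cnt y c).factorial ≤ (∑ c, (cnt y c : ℝ) * Real.log (cnt y c)) - n
      + Fintype.card C * (1 + Real.log n) := by
  have hs : ∑ c, (cnt y c : ℝ) = n := by exact_mod_cast cnt_sum y
  constructor
  · rw [← hs, ← Finset.sum_sub_distrib]
    exact Finset.sum_le_sum fun c _ => log_fact_lower _
  · have : (Fintype.card C : ℝ) * (1 + Real.log n) = ∑ _c : C, (1 + Real.log n) := by simp [mul_add]
    rw [this]
    nth_rw 1 [← hs]
    rw [← Finset.sum_sub_distrib, ← Finset.sum_add_distrib]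
    refine Finset.sum_le_sum fun c _ => (log_fact_upper _).trans ?_
    have : Real.log (cnt y c) ≤ Real.log n := by
      rcases Nat.eq_zero_or_pos (cnt y c) with h | h
      · rw [h]; simp; exact Real.log_natCast_nonneg n
      · exact Real.log_le_log (by exact_mod_cast h) (by exact_mod_cast cnt_le y c)
    linarith

lemma sum_ent {C : Type*} [Fintype C] [DecidableEq C] {n : ℕ} (hn : 0 < n) (y : Fin n → C) :
    (n : ℝ) * ∑ c, ((cnt y c : ℝ) / n) * Real.log ((cnt y c : ℝ) / n)
      = (∑ c, (cnt y c : ℝ) * Real.log (cnt y c)) - n * Real.log n := by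
  have hs : ∑ c, (cnt y c : ℝ) = n := by exact_mod_cast cnt_sum y
  have hn0 : (n : ℝ) ≠ 0 := by exact_mod_cast hn.ne'
  have h2 : (n : ℝ) * Real.log n = ∑ c, (cnt y c : ℝ) * Real.log n := by
    rw [← Finset.sum_mul, hs]
  rw [h2, Finset.mul_sum, ← Finset.sum_sub_distrib]
  refine Finset.sum_congr rfl fun c _ => ?_
  rcases Nat.eq_zero_or_pos (cnt y c) with h | h
  · rw [h]; simp
  · have : (cnt y c : ℝ) ≠ 0 := by exact_mod_cast h.ne'
    rw [Real.log_div this hn0]; field_simp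

/-- Joint empirical distribution. -/
def jt {A B : Type*} [DecidableEq A] [DecidableEq B] {n : ℕ} (x : Fin n → A) (w : Fin n → B) :
    A × B → ℝ := fun p => (cnt (fun i => (x i, w i)) p : ℝ) / n

lemma cnt_fst {A B : Type*} [DecidableEq A] [Fintype B] [DecidableEq B] {n : ℕ}
    (x : Fin n → A) (w : Fin n → B) (a : A) :
    ∑ b, cnt (fun i => (x i, w i)) (a, b) = cnt x a := by
  unfold cnt
  rw [Finset.card_eq_sum_card_fiberwise (f := w) (t := univ) (fun _ _ => by simp)]
  refine Finset.sum_congr rfl fun b _ => ?_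
  congr 1; ext i; simp

lemma cnt_snd {A B : Type*} [Fintype A] [DecidableEq A] [DecidableEq B] {n : ℕ}
    (x : Fin n → A) (w : Fin n → B) (b : B) :
    ∑ a, cnt (fun i => (x i, w i)) (a, b) = cnt w b := by
  unfold cnt
  rw [Finset.card_eq_sum_card_fiberwise (f := x) (t := univ) (fun _ _ => by simp)]
  refine Finset.sum_congr rfl fun b _ => ?_
  congr 1; ext i; simp [and_comm]

lemma jt_fst {A B : Type*} [DecidableEq A] [Fintype B] [DecidableEq B] {n : ℕ}
    (x : Fin n → A) (w : Fin n → B) (a : A) : ∑ b, jt x w (a, b) = (cnt x a : ℝ) / n := by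
  unfold jt
  rw [← Finset.sum_div, ← cnt_fst x w a]; push_cast; rfl

lemma jt_snd {A B : Type*} [Fintype A] [DecidableEq A] [DecidableEq B] {n : ℕ}
    (x : Fin n → A) (w : Fin n → B) (b : B) : ∑ a, jt x w (a, b) = (cnt w b : ℝ) / n := by
  unfold jt
  rw [← Finset.sum_div, ← cnt_snd x w b]; push_cast; rfl

/-- Conditional class of sequences having the same joint type with `w`. -/
def CC {A B : Type*} [Fintype A] [DecidableEq A] [Fintype B] [DecidableEq B] {n : ℕ}
    (x : Fin n → A) (w : Fin n → B) : Finset (Fin n → A) :=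
  univ.filter fun x' : Fin n → A => ∀ c, cnt (fun i => (x' i, w i)) c = cnt (fun i => (x i, w i)) c

lemma CC_pos {A B : Type*} [Fintype A] [DecidableEq A] [Fintype B] [DecidableEq B] {n : ℕ}
    (x : Fin n → A) (w : Fin n → B) : 0 < (CC x w).card :=
  Finset.card_pos.2 ⟨x, by simp [CC]⟩

/-- constant in the polynomial error terms -/
def kap (A B : Type*) [Fintype A] [Fintype B] : ℝ :=
  Fintype.card (A × B) + Fintype.card A + Fintype.card B + 1

lemma class_size {A B : Type*} [Fintype A] [DecidableEq A] [Fintype B] [DecidableEq B] {n : ℕ}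
    (hn : 0 < n) (x : Fin n → A) (w : Fin n → B) :
    |Real.log (CC x w).card - Real.log (TC x).card + n * (mutInfo (jt x w) * Real.log 2)|
      ≤ kap A B * (1 + Real.log n) := by
  have h1 := class_count x w
  have h2 := TC_count x
  have hN : ((CC x w).card : ℝ) ≠ 0 := by exact_mod_cast (CC_pos x w).ne'
  have hT : ((TC x).card : ℝ) ≠ 0 := by exact_mod_cast (TC_pos x).ne'
  have e1 : Real.log (CC x w).card + ∑ c, Real.log (cnt (fun i => (x i, w i)) c).factorial
      = ∑ b, Real.log (cnt w b).factorial := by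
    rw [← Real.log_prod (fun c _ => by exact_mod_cast (Nat.factorial_pos _).ne'),
      ← Real.log_prod (fun c _ => by exact_mod_cast (Nat.factorial_pos _).ne'),
      ← Real.log_mul hN (Finset.prod_ne_zero_iff.2 fun c _ => by
        exact_mod_cast (Nat.factorial_pos _).ne')]
    congr 1
    exact_mod_cast h1
  have e2 : Real.log (TC x).card + ∑ c, Real.log (cnt x c).factorial
      = Real.log n.factorial := by
    rw [← Real.log_prod (fun c _ => by exact_mod_cast (Nat.factorial_pos _).ne'),
      ← Real.log_mul hT (Finset.prod_ne_zero_iff.2 fun c _ => by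
        exact_mod_cast (Nat.factorial_pos _).ne')]
    congr 1
    exact_mod_cast h2
  have e3 := mutInfo_eq (jt x w) (fun p => by unfold jt; positivity)
  simp_rw [jt_fst, jt_snd] at e3
  have e4 : (n : ℝ) * (mutInfo (jt x w) * Real.log 2)
      = (∑ c, (cnt (fun i => (x i, w i)) c : ℝ) * Real.log (cnt (fun i => (x i, w i)) c))
        - (∑ a, (cnt x a : ℝ) * Real.log (cnt x a)) - (∑ b, (cnt w b : ℝ) * Real.log (cnt w b))
        + n * Real.log n := by
    rw [e3, mul_sub, mul_sub, sum_ent hn x, sum_ent hn w]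
    have := sum_ent hn (fun i => (x i, w i))
    unfold jt
    rw [this]; ring
  obtain ⟨a1, a2⟩ := sum_log_fact (fun i => (x i, w i))
  obtain ⟨b1, b2⟩ := sum_log_fact x
  obtain ⟨c1, c2⟩ := sum_log_fact w
  have d1 := log_fact_lower n
  have d2 := log_fact_upper n
  have hl : 0 ≤ Real.log n := Real.log_natCast_nonneg n
  have p1 : 0 ≤ (Fintype.card (A × B) : ℝ) * (1 + Real.log n) := by positivity
  have p2 : 0 ≤ (Fintype.card A : ℝ) * (1 + Real.log n) := by positivity
  have p3 : 0 ≤ (Fintype.card B : ℝ) * (1 + Real.log n) := by positivity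
  rw [e4, abs_le]
  unfold kap
  rw [add_mul, add_mul, add_mul]
  constructor <;> linarith

end SecureCodeD

section SecureCodeE
open Finset

lemma jt_dist {A B : Type*} [Fintype A] [DecidableEq A] [Fintype B] [DecidableEq B] {n : ℕ}
    (d : A → B → ℝ) (x : Fin n → A) (w : Fin n → B) :
    ∑ p : A × B, jt x w p * d p.1 p.2 = seqDist d x w := by
  unfold jt seqDist
  rw [← Finset.sum_fiberwise univ (fun i => (x i, w i)), Finset.mul_sum]
  refine Finset.sum_congr rfl fun p _ => ?_
  have : ∑ i ∈ univ.filter (fun i => (x i, w i) = p), d (x i) (w i)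
      = ∑ i ∈ univ.filter (fun i => (x i, w i) = p), d p.1 p.2 := by
    refine Finset.sum_congr rfl fun i hi => ?_
    rw [← (Finset.mem_filter.1 hi).2]
  rw [this, Finset.sum_const, nsmul_eq_mul]
  unfold cnt
  ring

lemma jt_isDist {A B : Type*} [Fintype A] [DecidableEq A] [Fintype B] [DecidableEq B] {n : ℕ}
    (hn : 0 < n) (x : Fin n → A) (w : Fin n → B) : IsDist (jt x w) := by
  constructor
  · intro p; unfold jt; positivity
  · unfold jt
    rw [← Finset.sum_div]
    have : ∑ c, (cnt (fun i => (x i, w i)) c : ℝ) = n := by exact_mod_cast cnt_sum _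
    rw [this, div_self (by exact_mod_cast hn.ne')]

lemma mutInfo_bdd {A B : Type*} [Fintype A] [Fintype B] (q : A × B → ℝ) (hq : IsDist q) :
    -(Fintype.card (A × B) : ℝ) / Real.log 2 ≤ mutInfo q := by
  have hl2 : 0 < Real.log 2 := Real.log_pos (by norm_num)
  rw [div_le_iff₀ hl2, mutInfo_eq q hq.1]
  have h1 : -(Fintype.card (A × B) : ℝ) ≤ ∑ p, q p * Real.log (q p) := by
    have : -(Fintype.card (A × B) : ℝ) = ∑ _p : A × B, (-1 : ℝ) := by simp
    rw [this]
    refine Finset.sum_le_sum fun p _ => ?_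
    rcases (hq.1 p).eq_or_lt with h | h
    · rw [← h]; simp
    · have := Real.one_sub_inv_le_log_of_pos h
      have h2 := mul_le_mul_of_nonneg_left this h.le
      rw [mul_sub, mul_inv_cancel₀ h.ne'] at h2
      linarith
  have h2 : ∑ a, (∑ b, q (a, b)) * Real.log (∑ b, q (a, b)) ≤ 0 := by
    refine Finset.sum_nonpos fun a _ => ?_
    have h0 : 0 ≤ ∑ b, q (a, b) := Finset.sum_nonneg fun b _ => hq.1 _
    refine mul_nonpos_of_nonneg_of_nonpos h0 (Real.log_nonpos h0 ?_)
    rw [← hq.2, Fintype.sum_prod_type]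
    exact Finset.single_le_sum (f := fun a => ∑ b, q (a, b))
      (fun a _ => Finset.sum_nonneg fun b _ => hq.1 _) (mem_univ a)
  have h3 : ∑ b, (∑ a, q (a, b)) * Real.log (∑ a, q (a, b)) ≤ 0 := by
    refine Finset.sum_nonpos fun b _ => ?_
    have h0 : 0 ≤ ∑ a, q (a, b) := Finset.sum_nonneg fun b _ => hq.1 _
    refine mul_nonpos_of_nonneg_of_nonpos h0 (Real.log_nonpos h0 ?_)
    rw [← hq.2, Fintype.sum_prod_type_right]
    exact Finset.single_le_sum (f := fun b => ∑ a, q (a, b))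
      (fun a _ => Finset.sum_nonneg fun b _ => hq.1 _) (mem_univ b)
  linarith

lemma rateDist_le {A B : Type*} [Fintype A] [Fintype B] (d : A → B → ℝ) (Q : A → ℝ) (D : ℝ)
    (q : A × B → ℝ) (hq : IsDist q) (hm : ∀ a, ∑ b, q (a, b) = Q a)
    (hd : ∑ p : A × B, q p * d p.1 p.2 ≤ D) : rateDist d Q D ≤ mutInfo q := by
  refine csInf_le ⟨-(Fintype.card (A × B) : ℝ) / Real.log 2, ?_⟩ ⟨q, hq, hm, hd, rfl⟩
  rintro r ⟨q', h1, -, -, rfl⟩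
  exact mutInfo_bdd q' h1

lemma TC_eq {A : Type*} [Fintype A] [DecidableEq A] {n : ℕ} {x y : Fin n → A} (h : y ∈ TC x) :
    TC y = TC x := by
  ext z
  rw [mem_TC, mem_TC]
  simp_rw [mem_TC.1 h]

open Classical in
lemma ball_upper {A B : Type*} [Fintype A] [DecidableEq A] [Fintype B] {n : ℕ}
    (hn : 0 < n) (x₀ : Fin n → A) (d : A → B → ℝ) (D : ℝ) (z : Fin n → B) :
    (((TC x₀).filter fun x => seqDist d x z ≤ D).card : ℝ)
      ≤ ((n : ℝ) + 1) ^ (Fintype.card (A × B)) *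
        Real.exp (kap A B * (1 + Real.log n) - n * (rateDist d (empDist x₀) D * Real.log 2))
        * (TC x₀).card := by
  set E := Real.exp (kap A B * (1 + Real.log n) - n * (rateDist d (empDist x₀) D * Real.log 2))
    with hE
  have hl2 : 0 < Real.log 2 := Real.log_pos (by norm_num)
  let f : (Fin n → A) → (A × B → Fin (n + 1)) := fun x p =>
    ⟨cnt (fun i => (x i, z i)) p, Nat.lt_succ_of_le (cnt_le _ _)⟩
  have hcard := Finset.card_eq_sum_card_fiberwise (f := f)
    (s := (TC x₀).filter fun x => seqDist d x z ≤ D) (t := univ) (fun _ _ => by simp)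
  rw [hcard]
  push_cast
  have hb : ∀ b : A × B → Fin (n + 1),
      ((((TC x₀).filter fun x => seqDist d x z ≤ D).filter fun x => f x = b).card : ℝ)
        ≤ E * (TC x₀).card := by
    intro b
    rcases (((TC x₀).filter fun x => seqDist d x z ≤ D).filter
      fun x => f x = b).eq_empty_or_nonempty with h | ⟨x, hx⟩
    · rw [h]; simp; positivity
    · simp only [mem_filter] at hx
      obtain ⟨⟨hx1, hx2⟩, hx3⟩ := hx
      have hsub : (((TC x₀).filter fun x => seqDist d x z ≤ D).filter fun x => f x = b)
          ⊆ CC x z := by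
        intro y hy
        simp only [mem_filter] at hy
        simp only [CC, mem_filter, mem_univ, true_and]
        intro c
        have := congrFun (hy.2.trans hx3.symm) c
        simpa [f] using this
      have h1 : ((((TC x₀).filter fun x => seqDist d x z ≤ D).filter fun x => f x = b).card : ℝ)
          ≤ (CC x z).card := by exact_mod_cast Finset.card_le_card hsub
      refine h1.trans ?_
      have hI : rateDist d (empDist x₀) D ≤ mutInfo (jt x z) := by
        refine rateDist_le d _ D _ (jt_isDist hn x z) (fun a => ?_) ?_
        · rw [jt_fst, mem_TC.1 hx1]; rfl
        · rw [jt_dist]; exact hx2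
      have h2 := (abs_le.1 (class_size hn x z)).2
      rw [TC_eq hx1] at h2
      have hT : (0 : ℝ) < (TC x₀).card := by exact_mod_cast TC_pos x₀
      have hN : (0 : ℝ) < (CC x z).card := by exact_mod_cast CC_pos x z
      rw [← Real.exp_log hN]
      conv_rhs => rw [← Real.exp_log hT]
      rw [hE, ← Real.exp_add]
      apply Real.exp_le_exp.2
      have h3 : (n : ℝ) * (rateDist d (empDist x₀) D * Real.log 2)
          ≤ n * (mutInfo (jt x z) * Real.log 2) := by gcongr
      linarith
  refine (Finset.sum_le_sum fun b _ => hb b).trans (le_of_eq ?_)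
  rw [Finset.sum_const, nsmul_eq_mul, Finset.card_univ, Fintype.card_fun, Fintype.card_fin]
  push_cast
  ring

lemma exists_cnt {C : Type*} [Fintype C] [DecidableEq C] {n : ℕ} (k : C → ℕ) (hk : ∑ c, k c = n) :
    ∃ y : Fin n → C, ∀ c, cnt y c = k c := by
  have e : Fin n ≃ Σ c, Fin (k c) := Fintype.equivOfCardEq (by simp [hk])
  refine ⟨fun i => (e i).1, fun c => ?_⟩
  unfold cnt
  have : (univ.filter fun i => (e i).1 = c).card
      = ((univ : Finset (Σ c, Fin (k c))).filter fun s => s.1 = c).card := by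
    refine Finset.card_bij (fun i _ => e i) ?_ ?_ ?_
    · intro i hi; simpa using hi
    · intro i _ j _ h; exact e.injective h
    · intro s hs; exact ⟨e.symm s, by simpa using hs, by simp⟩
  rw [this]
  have h2 : ((univ : Finset (Σ c, Fin (k c))).filter fun s => s.1 = c)
      = (univ : Finset (Fin (k c))).image (fun j => ⟨c, j⟩) := by
    ext ⟨c', j⟩
    simp only [mem_filter, mem_univ, true_and, mem_image]
    constructor
    · rintro rfl; exact ⟨j, rfl⟩
    · rintro ⟨j', h⟩; exact (congrArg Sigma.fst h).symm
  rw [h2, Finset.card_image_of_injective _ sigma_mk_injective]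
  simp

lemma exists_joint {A B : Type*} [Fintype A] [DecidableEq A] [Fintype B] [DecidableEq B] {n : ℕ}
    (x₀ : Fin n → A) (k : A × B → ℕ) (hk : ∀ a, ∑ b, k (a, b) = cnt x₀ a) :
    ∃ w : Fin n → B, ∀ c, cnt (fun i => (x₀ i, w i)) c = k c := by
  obtain ⟨y, hy⟩ := exists_cnt (n := n) k (by
    rw [Fintype.sum_prod_type]; simp_rw [hk]; exact cnt_sum x₀)
  obtain ⟨π, hπ⟩ := exists_perm (fun i => (y i).1) x₀ (fun a => by
    rw [← hk, ← cnt_fst (fun i => (y i).1) (fun i => (y i).2) a]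
    exact Finset.sum_congr rfl fun b _ => hy _)
  refine ⟨fun i => (y (π i)).2, fun c => ?_⟩
  rw [← hy c, ← cnt_comp_perm y π c]
  congr 1
  funext i
  rw [← hπ]; rfl

/-- Rounding a joint distribution to a joint type with the right marginal. -/
lemma rounding {A B : Type*} [Fintype A] [DecidableEq A] [Fintype B] [DecidableEq B] {n : ℕ}
    (hn : 0 < n) (x₀ : Fin n → A) (d : A → B → ℝ) (hd0 : ∀ a b, 0 ≤ d a b)
    (ws : A → B) (hws : ∀ a, d a (ws a) = 0)
    (q : A × B → ℝ) (hq : IsDist q) (hm : ∀ a, ∑ b, q (a, b) = empDist x₀ a) :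
    ∃ w : Fin n → B, (∀ p, |jt x₀ w p - q p| ≤ Fintype.card B / n) ∧
      ∑ p : A × B, jt x₀ w p * d p.1 p.2 ≤ ∑ p : A × B, q p * d p.1 p.2 := by
  have hn0 : (0 : ℝ) < n := by exact_mod_cast hn
  have hmn : ∀ a, ∑ b, (n : ℝ) * q (a, b) = cnt x₀ a := by
    intro a
    rw [← Finset.mul_sum, hm a]
    show (n : ℝ) * ((cnt x₀ a : ℝ) / n) = _
    field_simp
  have hnq : ∀ p, 0 ≤ (n : ℝ) * q p := fun p => mul_nonneg hn0.le (hq.1 p)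
  have hsum : ∀ a, ∑ b ∈ univ.erase (ws a), ⌊(n : ℝ) * q (a, b)⌋₊ ≤ cnt x₀ a := by
    intro a
    have : ((∑ b ∈ univ.erase (ws a), ⌊(n : ℝ) * q (a, b)⌋₊ : ℕ) : ℝ) ≤ cnt x₀ a := by
      rw [← hmn a]
      push_cast
      calc ∑ b ∈ univ.erase (ws a), (⌊(n : ℝ) * q (a, b)⌋₊ : ℝ)
          ≤ ∑ b ∈ univ.erase (ws a), (n : ℝ) * q (a, b) :=
            Finset.sum_le_sum fun b _ => Nat.floor_le (hnq _)
        _ ≤ _ := Finset.sum_le_sum_of_subset_of_nonneg (Finset.erase_subset _ _)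
            fun b _ _ => hnq _
    exact_mod_cast this
  let k : A × B → ℕ := fun p => if p.2 = ws p.1 then
    cnt x₀ p.1 - ∑ b ∈ univ.erase (ws p.1), ⌊(n : ℝ) * q (p.1, b)⌋₊ else ⌊(n : ℝ) * q p⌋₊
  have hke : ∀ a, ∑ b ∈ univ.erase (ws a), k (a, b)
      = ∑ b ∈ univ.erase (ws a), ⌊(n : ℝ) * q (a, b)⌋₊ := by
    intro a
    refine Finset.sum_congr rfl fun b hb => ?_
    simp only [k]; rw [if_neg (Finset.ne_of_mem_erase hb)]
  have hkw : ∀ a, k (a, ws a) = cnt x₀ a - ∑ b ∈ univ.erase (ws a), ⌊(n : ℝ) * q (a, b)⌋₊ := by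
    intro a; simp [k]
  have hk : ∀ a, ∑ b, k (a, b) = cnt x₀ a := by
    intro a
    rw [← Finset.add_sum_erase univ _ (mem_univ (ws a)), hke, hkw]
    exact Nat.sub_add_cancel (hsum a)
  obtain ⟨w, hw⟩ := exists_joint x₀ k hk
  refine ⟨w, fun p => ?_, ?_⟩
  · have hB : (1 : ℝ) ≤ Fintype.card B := by
      exact_mod_cast Fintype.card_pos_iff.2 ⟨p.2⟩
    have hkp : |(k p : ℝ) - n * q p| ≤ Fintype.card B := by
      obtain ⟨a, b⟩ := p
      by_cases hb : b = ws a
      · subst hb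
        have h1 : ∑ b ∈ univ.erase (ws a), ((n : ℝ) * q (a, b)) + n * q (a, ws a)
            = cnt x₀ a := by
          rw [← hmn a, Finset.sum_erase_add _ _ (mem_univ _)]
        have h2 : (k (a, ws a) : ℝ) - n * q (a, ws a)
            = ∑ b ∈ univ.erase (ws a), ((n : ℝ) * q (a, b) - ⌊(n : ℝ) * q (a, b)⌋₊) := by
          rw [hkw, Nat.cast_sub (hsum a), Finset.sum_sub_distrib]
          push_cast
          linarith
        rw [h2, abs_le]
        constructor
        · have : 0 ≤ ∑ b ∈ univ.erase (ws a), ((n : ℝ) * q (a, b) - ⌊(n : ℝ) * q (a, b)⌋₊) :=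
            Finset.sum_nonneg fun b _ => sub_nonneg.2 (Nat.floor_le (hnq _))
          linarith
        · calc _ ≤ ∑ b ∈ univ.erase (ws a), (1 : ℝ) := Finset.sum_le_sum fun b _ => by
                have := Nat.lt_floor_add_one ((n : ℝ) * q (a, b)); linarith
            _ ≤ ∑ b : B, (1 : ℝ) := Finset.sum_le_sum_of_subset_of_nonneg (Finset.erase_subset _ _)
                (fun _ _ _ => zero_le_one)
            _ = _ := by simp
      · have : k (a, b) = ⌊(n : ℝ) * q (a, b)⌋₊ := by simp [k, hb]
        rw [this, abs_le]
        have h1 := Nat.lt_floor_add_one ((n : ℝ) * q (a, b))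
        have h2 := Nat.floor_le (hnq (a, b))
        constructor <;> linarith
    have : jt x₀ w p - q p = ((k p : ℝ) - n * q p) / n := by
      unfold jt; rw [hw]; field_simp
    rw [this, abs_div, abs_of_pos hn0]
    gcongr
  · refine Finset.sum_le_sum fun p _ => ?_
    obtain ⟨a, b⟩ := p
    by_cases hb : b = ws a
    · subst hb; simp [hws]
    · have : k (a, b) = ⌊(n : ℝ) * q (a, b)⌋₊ := by simp [k, hb]
      refine mul_le_mul_of_nonneg_right ?_ (hd0 _ _)
      unfold jt
      rw [hw, this, div_le_iff₀ hn0, mul_comm (q (a, b))]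
      exact Nat.floor_le (hnq _)

end SecureCodeE

section SecureCodeF
open Finset Filter

lemma eventually_log_small (c ε : ℝ) (hc : 0 ≤ c) (hε : 0 < ε) :
    ∀ᶠ n : ℕ in atTop, c * (1 + Real.log (n + 1)) ≤ ε * n := by
  have h1 : ∀ᶠ x : ℝ in atTop, ‖Real.log x‖ ≤ (ε / (4 * (c + 1))) * ‖id x‖ :=
    Real.isLittleO_log_id_atTop.bound (by positivity)
  have h2 : Tendsto (fun n : ℕ => (n : ℝ) + 1) atTop atTop :=
    tendsto_atTop_add_const_right _ _ tendsto_natCast_atTop_atTop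
  have h3 : ∀ᶠ n : ℕ in atTop, 2 * c / ε + 1 ≤ (n : ℝ) :=
    tendsto_natCast_atTop_atTop.eventually_ge_atTop _
  filter_upwards [h2.eventually h1, h3] with n hn1 hn2
  have hn0 : (1 : ℝ) ≤ n := by
    have : 0 ≤ 2 * c / ε := by positivity
    linarith
  have hn1' : Real.log ((n : ℝ) + 1) ≤ ε / (4 * (c + 1)) * (n + 1) := by
    have := (Real.le_norm_self _).trans hn1
    simp only [id, Real.norm_eq_abs] at this
    rwa [abs_of_pos (by positivity)] at this
  have h5 : c * Real.log ((n : ℝ) + 1) ≤ ε / 2 * n := by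
    have : c * Real.log ((n : ℝ) + 1) ≤ c * (ε / (4 * (c + 1)) * (n + 1)) := by gcongr
    refine this.trans ?_
    have e : c * (ε / (4 * (c + 1)) * (n + 1)) = (c / (c + 1)) * (ε / 4 * (n + 1)) := by
      field_simp
    rw [e]
    have h6 : c / (c + 1) ≤ 1 := by rw [div_le_one (by positivity)]; linarith
    have h7 : 0 ≤ ε / 4 * ((n : ℝ) + 1) := by positivity
    calc _ ≤ 1 * (ε / 4 * ((n : ℝ) + 1)) := by gcongr
      _ ≤ ε / 4 * (2 * n) := by rw [one_mul]; gcongr; linarith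
      _ = _ := by ring
  have h6 : c ≤ ε / 2 * n := by
    have : ε / 2 * (2 * c / ε) = c := by field_simp
    have h8 : ε / 2 * (2 * c / ε) ≤ ε / 2 * n := by gcongr; linarith
    linarith
  linarith

lemma mutInfo_cont {A B : Type*} [Fintype A] [Fintype B] (q : A × B → ℝ) (hq : ∀ p, 0 ≤ q p)
    (ε : ℝ) (hε : 0 < ε) :
    ∃ η > 0, ∀ q' : A × B → ℝ, (∀ p, 0 ≤ q' p) → (∀ p, |q' p - q p| ≤ η) →
      mutInfo q' ≤ mutInfo q + ε := by
  have hl2 : 0 < Real.log 2 := Real.log_pos (by norm_num)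
  let G : (A × B → ℝ) → ℝ := fun q => ∑ p, q p * Real.log (q p)
      - ∑ a, (∑ b, q (a, b)) * Real.log (∑ b, q (a, b))
      - ∑ b, (∑ a, q (a, b)) * Real.log (∑ a, q (a, b))
  have hG : Continuous G := by
    refine Continuous.sub (Continuous.sub ?_ ?_) ?_
    · exact continuous_finsetSum _ fun p _ => Real.continuous_mul_log.comp (continuous_apply p)
    · exact continuous_finsetSum _ fun a _ => Real.continuous_mul_log.comp
        (continuous_finsetSum _ fun b _ => continuous_apply _)
    · exact continuous_finsetSum _ fun a _ => Real.continuous_mul_log.comp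
        (continuous_finsetSum _ fun b _ => continuous_apply _)
  obtain ⟨η, hη, h⟩ := Metric.continuousAt_iff.1 (hG.continuousAt (x := q)) (ε * Real.log 2)
    (by positivity)
  refine ⟨η / 2, by positivity, fun q' hq' hd => ?_⟩
  have h1 : dist q' q < η := by
    refine lt_of_le_of_lt ((dist_pi_le_iff (r := η / 2) (by positivity)).2 fun p => ?_)
      (by linarith)
    rw [Real.dist_eq]; exact hd p
  have h2 := h h1
  rw [Real.dist_eq] at h2
  have h3 := (abs_lt.1 h2).2
  have e1 : G q' = mutInfo q' * Real.log 2 := (mutInfo_eq q' hq').symm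
  have e2 : G q = mutInfo q * Real.log 2 := (mutInfo_eq q hq).symm
  rw [e1, e2] at h3
  have h4 : mutInfo q' * Real.log 2 ≤ (mutInfo q + ε) * Real.log 2 := by linarith
  exact le_of_mul_le_mul_right h4 hl2

open Classical in
lemma ball_lower {A B : Type*} [Fintype A] [DecidableEq A] [Fintype B]
    (d : A → B → ℝ) (hd0 : ∀ a b, 0 ≤ d a b)
    (ws : A → B) (hws : ∀ a, d a (ws a) = 0) (Q : A → ℝ) (Dc : ℝ) (hDc : 0 ≤ Dc)
    (hQ : ∃ (n : ℕ) (x : Fin n → A), 0 < n ∧ empDist x = Q) (ε : ℝ) (hε : 0 < ε) :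
    ∃ n₀ : ℕ, ∀ n, n₀ ≤ n → 0 < n → ∀ x₀ : Fin n → A, empDist x₀ = Q →
      ∃ w : Fin n → B, Real.log (TC x₀).card
        ≤ Real.log ((TC x₀).filter fun y => seqDist d y w ≤ Dc).card
          + n * ((rateDist d Q Dc + ε) * Real.log 2) := by
  have hl2 : 0 < Real.log 2 := Real.log_pos (by norm_num)
  obtain ⟨q, hq, hm, hqd, hqI⟩ : ∃ q : A × B → ℝ, IsDist q ∧ (∀ a, ∑ b, q (a, b) = Q a) ∧
      ∑ p : A × B, q p * d p.1 p.2 ≤ Dc ∧ mutInfo q < rateDist d Q Dc + ε / 3 := by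
    have hlt : rateDist d Q Dc < rateDist d Q Dc + ε / 3 := by linarith
    obtain ⟨r, ⟨q, h1, h2, h3, rfl⟩, h5⟩ := exists_lt_of_csInf_lt (by
      obtain ⟨n, x, hn, hx⟩ := hQ
      refine ⟨_, jt x (ws ∘ x), jt_isDist hn _ _, fun a => ?_, ?_, rfl⟩
      · rw [jt_fst, ← hx]; rfl
      · rw [jt_dist]
        simpa [seqDist, hws] using hDc) hlt
    exact ⟨q, h1, h2, h3, h5⟩
  obtain ⟨η, hη, hcont⟩ := mutInfo_cont q hq.1 (ε / 3) (by positivity)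
  have hk0 : 0 ≤ kap A B := by unfold kap; positivity
  have ev1 := eventually_log_small (kap A B) (ε / 3 * Real.log 2) hk0 (by positivity)
  have ev2 : ∀ᶠ n : ℕ in atTop, (Fintype.card B : ℝ) / η ≤ (n : ℝ) :=
    tendsto_natCast_atTop_atTop.eventually_ge_atTop _
  obtain ⟨n₀, hn₀⟩ := eventually_atTop.1 (ev1.and ev2)
  refine ⟨n₀, fun n hn hnpos x₀ hx₀ => ?_⟩
  obtain ⟨h1, h2⟩ := hn₀ n hn
  have hn0 : (0 : ℝ) < n := by exact_mod_cast hnpos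
  obtain ⟨w, hw1, hw2⟩ := rounding hnpos x₀ d hd0 ws hws q hq (fun a => by rw [hm, hx₀])
  refine ⟨w, ?_⟩
  have hI : mutInfo (jt x₀ w) ≤ rateDist d Q Dc + 2 * (ε / 3) := by
    have := hcont (jt x₀ w) (jt_isDist hnpos x₀ w).1 (fun p => (hw1 p).trans (by
      rw [div_le_iff₀ hn0]; rw [div_le_iff₀ hη] at h2; linarith))
    linarith
  have hsub : CC x₀ w ⊆ (TC x₀).filter fun y => seqDist d y w ≤ Dc := by
    intro y hy
    simp only [CC, mem_filter, mem_univ, true_and] at hy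
    refine Finset.mem_filter.2 ⟨mem_TC.2 fun a => ?_, ?_⟩
    · rw [← cnt_fst y w, ← cnt_fst x₀ w]
      exact Finset.sum_congr rfl fun b _ => hy _
    · rw [← jt_dist]
      have : jt y w = jt x₀ w := by funext p; unfold jt; rw [hy]
      rw [this]; exact hw2.trans hqd
  have hCC : (0 : ℝ) < (CC x₀ w).card := by exact_mod_cast CC_pos x₀ w
  have h3 : Real.log (CC x₀ w).card
      ≤ Real.log ((TC x₀).filter fun y => seqDist d y w ≤ Dc).card :=
    Real.log_le_log hCC (by exact_mod_cast Finset.card_le_card hsub)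
  have h4 := (abs_le.1 (class_size hnpos x₀ w)).1
  have h5 : (n : ℝ) * (mutInfo (jt x₀ w) * Real.log 2)
      ≤ n * ((rateDist d Q Dc + 2 * (ε / 3)) * Real.log 2) := by gcongr
  have h6 : kap A B * (1 + Real.log n) ≤ kap A B * (1 + Real.log (n + 1)) := by
    gcongr; linarith
  have h7 : (n : ℝ) * ((rateDist d Q Dc + ε) * Real.log 2)
      = n * ((rateDist d Q Dc + 2 * (ε / 3)) * Real.log 2) + ε / 3 * Real.log 2 * n := by ring
  linarith

/-- polynomial-error constant for the eavesdropper bound -/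
def kapE (A Z : Type*) [Fintype A] [Fintype Z] : ℝ :=
  Real.log (2 + (2 * Real.log (Fintype.card A) + Real.log (Fintype.card Z)))
    + Fintype.card (A × Z) + kap A Z + 1

lemma kapE_nonneg (A Z : Type*) [Fintype A] [Fintype Z] : 0 ≤ kapE A Z := by
  unfold kapE kap
  have h1 : 0 ≤ Real.log (Fintype.card A) := Real.log_natCast_nonneg _
  have h2 : 0 ≤ Real.log (Fintype.card Z) := Real.log_natCast_nonneg _
  have := Real.log_nonneg (x := 2 + (2 * Real.log (Fintype.card A) + Real.log (Fintype.card Z)))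
    (by linarith)
  positivity

lemma exponent_bound (A Z : Type*) [Fintype A] [Nonempty A] [Fintype Z] [Nonempty Z] {n k : ℕ}
    (R r : ℝ) (hk : (n : ℝ) * R ≤ k) :
    2 * (((n : ℝ) + 1) ^ (Fintype.card (A × Z)) *
        Real.exp (kap A Z * (1 + Real.log n) - n * (r * Real.log 2)))
      + Real.log ((Fintype.card A : ℝ) ^ n * Fintype.card A ^ n * Fintype.card Z ^ n) / 2 ^ k
      ≤ Real.exp (kapE A Z * (1 + Real.log (n + 1)) - n * (min R r * Real.log 2)) := by
  have hl2 : 0 < Real.log 2 := Real.log_pos (by norm_num)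
  have hA : (Fintype.card A : ℝ) ≠ 0 := by exact_mod_cast Fintype.card_ne_zero
  have hZ : (Fintype.card Z : ℝ) ≠ 0 := by exact_mod_cast Fintype.card_ne_zero
  have h1 : 0 ≤ Real.log (Fintype.card A) := Real.log_natCast_nonneg _
  have h2 : 0 ≤ Real.log (Fintype.card Z) := Real.log_natCast_nonneg _
  have hell : Real.log ((Fintype.card A : ℝ) ^ n * Fintype.card A ^ n * Fintype.card Z ^ n)
      = n * (2 * Real.log (Fintype.card A) + Real.log (Fintype.card Z)) := by
    rw [Real.log_mul (by positivity) (by positivity), Real.log_mul (by positivity) (by positivity),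
      Real.log_pow, Real.log_pow]; ring
  rw [hell]
  set c := 2 * Real.log (Fintype.card A) + Real.log (Fintype.card Z) with hc
  have hc0 : 0 ≤ c := by positivity
  have hn1 : (0 : ℝ) < (n : ℝ) + 1 := by positivity
  set L := Real.log ((n : ℝ) + 1) with hL
  have hL0 : 0 ≤ L := Real.log_nonneg (by linarith [(Nat.cast_nonneg n : (0 : ℝ) ≤ n)])
  have hLn : Real.log n ≤ L := by
    rcases Nat.eq_zero_or_pos n with h | h
    · rw [h]; simpa using hL0
    · exact Real.log_le_log (by exact_mod_cast h) (by linarith)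
  have hexpL : Real.exp L = (n : ℝ) + 1 := Real.exp_log hn1
  have hkap : 0 ≤ kap A Z := by unfold kap; positivity
  set μ := min R r with hμ
  set m : ℝ := ((Fintype.card (A × Z) : ℕ) : ℝ) with hm
  have hm0 : 0 ≤ m := by positivity
  set W := Real.exp ((m + kap A Z + 1) * (1 + L) - n * (μ * Real.log 2)) with hW
  have t1 : ((n : ℝ) + 1) ^ (Fintype.card (A × Z)) *
        Real.exp (kap A Z * (1 + Real.log n) - n * (r * Real.log 2)) ≤ W := by
    rw [← hexpL, ← Real.exp_nat_mul, ← Real.exp_add, hW]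
    apply Real.exp_le_exp.2
    have a1 : (n : ℝ) * (μ * Real.log 2) ≤ n * (r * Real.log 2) := by
      gcongr; exact min_le_right _ _
    have a2 : kap A Z * (1 + Real.log n) ≤ kap A Z * (1 + L) := by gcongr
    have a3 : (Fintype.card (A × Z) : ℝ) * L = m * L := rfl
    have a4 : (m + kap A Z + 1) * (1 + L) = m + m * L + kap A Z * (1 + L) + 1 + L := by ring
    rw [a3, a4]; linarith
  have t2 : (n : ℝ) * c / 2 ^ k ≤ c * W := by
    have b1 : ((2 : ℝ) ^ k) = Real.exp (k * Real.log 2) := by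
      rw [Real.exp_nat_mul, Real.exp_log (by norm_num)]
    rw [b1, div_eq_mul_inv, ← Real.exp_neg, mul_comm (n : ℝ) c, mul_assoc]
    apply mul_le_mul_of_nonneg_left _ hc0
    have b2 : (n : ℝ) ≤ Real.exp L := by rw [hexpL]; linarith
    calc (n : ℝ) * Real.exp (-(k * Real.log 2)) ≤ Real.exp L * Real.exp (-(k * Real.log 2)) := by
          gcongr
      _ ≤ W := by
        rw [← Real.exp_add, hW]
        apply Real.exp_le_exp.2
        have a1 : (n : ℝ) * (μ * Real.log 2) ≤ k * Real.log 2 := by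
          rw [← mul_assoc]
          gcongr
          refine le_trans ?_ hk
          gcongr; exact min_le_left _ _
        have a4 : 0 ≤ (m + kap A Z) * (1 + L) := by positivity
        have a5 : (m + kap A Z + 1) * (1 + L) = (m + kap A Z) * (1 + L) + 1 + L := by ring
        rw [a5]; linarith
  have h2c : 0 < 2 + c := by positivity
  calc _ ≤ 2 * W + c * W := by linarith
    _ = Real.exp (Real.log (2 + c)) * W := by rw [Real.exp_log h2c]; ring
    _ ≤ _ := by
      rw [hW, ← Real.exp_add]
      apply Real.exp_le_exp.2
      have a1 : 0 ≤ Real.log (2 + c) := Real.log_nonneg (by linarith)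
      have a2 : 0 ≤ Real.log (2 + c) * L := by positivity
      have a3 : kapE A Z = Real.log (2 + c) + m + kap A Z + 1 := rfl
      rw [a3]; linarith

end SecureCodeF

/-- **Single-type secure rate-distortion code.** For a full-support type `Q`, along the
blocklengths `n_l` with nonempty type class there are fixed key rate `R` secure rate-distortion
codes whose coding rate is asymptotically at most `R_{d_L}(Q,Dc) + δ`, whose legitimate
reproduction always meets the distortion level `Dc` on `T_{n_l}(Q)`, and whose conditional
exiguous-distortion exponent is at least `min{R, R_{d_E}(Q,D)} − δ` for every `D ≥ Dc`. -/
theorem single_type_secure_code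
    {𝓧 𝓦 𝓩 : Type*} [Fintype 𝓧] [DecidableEq 𝓧] [Fintype 𝓦] [Fintype 𝓩]
    [Nonempty 𝓦] [Nonempty 𝓩]
    (dL : 𝓧 → 𝓦 → ℝ) (dE : 𝓧 → 𝓩 → ℝ)
    (hdL0 : ∀ x w, 0 ≤ dL x w) (hdE0 : ∀ x z, 0 ≤ dE x z)
    (hzeroL : ∀ x, ∃ w, dL x w = 0) (hzeroE : ∀ x, ∃ z, dE x z = 0)
    (δ : ℝ) (hδ : 0 < δ) (Dc : ℝ) (hDc : 0 ≤ Dc) (R : ℝ) (hR : 0 < R)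
    (Q : 𝓧 → ℝ) (hQfull : ∀ a, 0 < Q a)
    (hQ : ∃ (n : ℕ) (x : Fin n → 𝓧), 0 < n ∧ empDist x = Q)
    (nl : ℕ → ℕ) (hnl : StrictMono nl)
    (hnlne : ∀ l, (typeClass 𝓧 (nl l) Q).Nonempty)
    (hnlall : ∀ n, 0 < n → (typeClass 𝓧 n Q).Nonempty → ∃ l, nl l = n) :
    ∃ (m : ℕ → ℕ)
      (f : ∀ l : ℕ, (Fin (nl l) → 𝓧) → (Fin ⌈(nl l : ℝ) * R⌉₊ → Bool) → Fin (m l))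
      (φ : ∀ l : ℕ, Fin (m l) → (Fin ⌈(nl l : ℝ) * R⌉₊ → Bool) → (Fin (nl l) → 𝓦)),
      -- (i) coding rate
      Filter.limsup (fun l : ℕ => (nl l : ℝ)⁻¹ * Real.logb 2 (m l)) Filter.atTop
        ≤ rateDist dL Q Dc + δ ∧
      -- (ii) zero excess-distortion on the type class
      (∀ (l : ℕ) (x : Fin (nl l) → 𝓧) (u : Fin ⌈(nl l : ℝ) * R⌉₊ → Bool),
        x ∈ typeClass 𝓧 (nl l) Q → seqDist dL x (φ l (f l x u) u) ≤ Dc) ∧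
      -- (iii) conditional exiguous-distortion exponent
      (∀ D : ℝ, Dc ≤ D →
        min R (rateDist dE Q D) - δ
          ≤ Filter.liminf (fun l : ℕ =>
              -(nl l : ℝ)⁻¹ * Real.logb 2
                (⨆ σ : Fin (m l) → (Fin (nl l) → 𝓩),
                  (((typeClass 𝓧 (nl l) Q).ncard : ℝ)
                      * (2 : ℝ) ^ (⌈(nl l : ℝ) * R⌉₊ : ℕ))⁻¹ *
                    ∑ x : Fin (nl l) → 𝓧, ∑ u : Fin ⌈(nl l : ℝ) * R⌉₊ → Bool,
                      ind (x ∈ typeClass 𝓧 (nl l) Q ∧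
                        seqDist dE x (σ (f l x u)) ≤ D)))
              Filter.atTop) := by
  classical
  obtain ⟨N₀, X₀, hN₀, hX₀⟩ := hQ
  have hneX : Nonempty 𝓧 := ⟨X₀ ⟨0, hN₀⟩⟩
  have hl2 : 0 < Real.log 2 := Real.log_pos (by norm_num)
  choose x hx using hnlne
  have hxQ : ∀ l, empDist (x l) = Q := hx
  have hnpos : ∀ l, 0 < nl l := by
    intro l
    rcases Nat.eq_zero_or_pos (nl l) with h | h
    · exfalso
      have h1 := congrFun (hxQ l) (Classical.arbitrary 𝓧)
      have h2 := hQfull (Classical.arbitrary 𝓧)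
      have h3 : ((nl l : ℕ) : ℝ) = 0 := by rw [h]; simp
      unfold empDist at h1
      rw [h3, div_zero] at h1
      linarith
    · exact h
  have hnpos' : ∀ l, (0 : ℝ) < nl l := fun l => by exact_mod_cast hnpos l
  have hmem : ∀ l (y : Fin (nl l) → 𝓧), y ∈ typeClass 𝓧 (nl l) Q ↔ y ∈ TC (x l) := by
    intro l y
    rw [mem_TC]
    constructor
    · intro hy a
      have h1 : empDist y a = empDist (x l) a := by
        rw [hxQ l]; exact congrFun hy a
      have h2 : (cnt y a : ℝ) / nl l = (cnt (x l) a : ℝ) / nl l := h1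
      rw [div_left_inj' (hnpos' l).ne'] at h2
      exact_mod_cast h2
    · intro hy
      show empDist y = Q
      rw [← hxQ l]
      funext a
      show (cnt y a : ℝ) / nl l = (cnt (x l) a : ℝ) / nl l
      rw [hy a]
  have hncard : ∀ l, (typeClass 𝓧 (nl l) Q).ncard = (TC (x l)).card := by
    intro l
    rw [← Set.ncard_coe_finset]
    congr 1
    ext y
    rw [hmem l y]; rfl
  choose ws hws using hzeroL
  choose zs hzs using hzeroE
  have hmax : ∀ l, ∃ w : Fin (nl l) → 𝓦, ∀ w',
      ((TC (x l)).filter fun y => seqDist dL y w' ≤ Dc).card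
        ≤ ((TC (x l)).filter fun y => seqDist dL y w ≤ Dc).card := by
    intro l
    obtain ⟨w, -, hw⟩ := Finset.exists_max_image (Finset.univ : Finset (Fin (nl l) → 𝓦))
      (fun w => ((TC (x l)).filter fun y => seqDist dL y w ≤ Dc).card) Finset.univ_nonempty
    exact ⟨w, fun w' => hw w' (Finset.mem_univ _)⟩
  choose w hw using hmax
  have hSne : ∀ l, ((TC (x l)).filter fun y => seqDist dL y (w l) ≤ Dc).Nonempty := by
    intro l
    rw [← Finset.card_pos]
    refine lt_of_lt_of_le ?_ (hw l (ws ∘ x l))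
    rw [Finset.card_pos]
    refine ⟨x l, Finset.mem_filter.2 ⟨mem_TC.2 fun _ => rfl, ?_⟩⟩
    simpa [seqDist, hws] using hDc
  choose m f φ hm0 hmle hφ hsec using fun l => code_exists ⌈(nl l : ℝ) * R⌉₊ (x l) dL dE Dc (w l)
    (hSne l)
  have hTpos : ∀ l, (0 : ℝ) < (TC (x l)).card := fun l => by exact_mod_cast TC_pos (x l)
  have hTle : ∀ l, Real.log (TC (x l)).card ≤ nl l * Real.log (Fintype.card 𝓧) := by
    intro l
    rw [← Real.log_pow]
    apply Real.log_le_log (hTpos l)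
    have := Finset.card_le_univ (TC (x l))
    rw [Fintype.card_fun, Fintype.card_fin] at this
    exact_mod_cast this
  have hlogX : 0 ≤ Real.log (Fintype.card 𝓧) := Real.log_natCast_nonneg _
  refine ⟨m, f, φ, ?_, ?_, ?_⟩
  · -- coding rate
    obtain ⟨n₀, hn₀⟩ := ball_lower dL hdL0 ws hws Q Dc hDc ⟨N₀, X₀, hN₀, hX₀⟩ (δ / 2) (by positivity)
    have hlc : 0 ≤ Real.log (Real.log (Fintype.card 𝓧) + 1) := Real.log_nonneg (by linarith)
    have ev1 := eventually_log_small (Real.log (Real.log (Fintype.card 𝓧) + 1) + 1)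
      (δ / 2 * Real.log 2) (by positivity) (by positivity)
    have ev := hnl.tendsto_atTop.eventually (ev1.and (Filter.eventually_ge_atTop n₀))
    refine Filter.limsup_le_of_le
      (Filter.isCoboundedUnder_le_of_le Filter.atTop (x := (0 : ℝ)) ?_) ?_
    · intro l
      apply mul_nonneg (by positivity)
      apply Real.logb_nonneg (by norm_num)
      exact_mod_cast hm0 l
    · filter_upwards [ev] with l hl
      obtain ⟨hl1, hl2'⟩ := hl
      obtain ⟨w', hw'⟩ := hn₀ (nl l) hl2' (hnpos l) (x l) (hxQ l)
      have hSpos : (0 : ℝ) < ((TC (x l)).filter fun y => seqDist dL y (w l) ≤ Dc).card := by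
        exact_mod_cast Finset.card_pos.2 (hSne l)
      have hS : Real.log ((TC (x l)).filter fun y => seqDist dL y w' ≤ Dc).card
          ≤ Real.log ((TC (x l)).filter fun y => seqDist dL y (w l) ≤ Dc).card := by
        rcases Nat.eq_zero_or_pos ((TC (x l)).filter fun y => seqDist dL y w' ≤ Dc).card with h | h
        · rw [h]; simp only [Nat.cast_zero, Real.log_zero]; exact Real.log_natCast_nonneg _
        · exact Real.log_le_log (by exact_mod_cast h) (by exact_mod_cast hw l w')
      have hlT : 0 ≤ Real.log (TC (x l)).card := Real.log_natCast_nonneg _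
      have hmpos : (0 : ℝ) < m l := by exact_mod_cast hm0 l
      have hM := Real.log_le_log hmpos (hmle l)
      rw [Real.log_mul (div_pos (hTpos l) hSpos).ne' (by positivity),
        Real.log_div (hTpos l).ne' hSpos.ne'] at hM
      have hM2 : Real.log (Real.log (TC (x l)).card + 1)
          ≤ Real.log (Real.log (Fintype.card 𝓧) + 1) + Real.log ((nl l : ℝ) + 1) := by
        rw [← Real.log_mul (by positivity) (by have := hnpos' l; positivity)]
        apply Real.log_le_log (by positivity)
        have := hTle l
        have h0 := hnpos' l
        nlinarith
      have hlogn : 0 ≤ Real.log ((nl l : ℝ) + 1) :=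
        Real.log_nonneg (by have := hnpos' l; linarith)
      have hM3 : Real.log (m l) ≤ nl l * ((rateDist dL Q Dc + δ) * Real.log 2) := by
        have e1 : (nl l : ℝ) * ((rateDist dL Q Dc + δ) * Real.log 2)
          = nl l * ((rateDist dL Q Dc + δ / 2) * Real.log 2) + δ / 2 * Real.log 2 * nl l := by ring
        have e2 : 0 ≤ Real.log (Real.log (Fintype.card 𝓧) + 1) * Real.log ((nl l : ℝ) + 1) := by
          positivity
        nlinarith
      rw [inv_mul_le_iff₀ (hnpos' l), Real.logb, div_le_iff₀ hl2]
      linarith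
  · -- legitimate distortion
    intro l y u hy
    exact hφ l y ((hmem l y).1 hy) u
  · -- exponent
    intro D hD
    have hD0 : 0 ≤ D := hDc.trans hD
    set r := rateDist dE Q D with hr
    have hP : ∀ l, ∀ σ : Fin (m l) → (Fin (nl l) → 𝓩),
        (((typeClass 𝓧 (nl l) Q).ncard : ℝ) * (2 : ℝ) ^ (⌈(nl l : ℝ) * R⌉₊ : ℕ))⁻¹ *
          ∑ x : Fin (nl l) → 𝓧, ∑ u : Fin ⌈(nl l : ℝ) * R⌉₊ → Bool,
            ind (x ∈ typeClass 𝓧 (nl l) Q ∧ seqDist dE x (σ (f l x u)) ≤ D)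
        ≤ Real.exp (kapE 𝓧 𝓩 * (1 + Real.log (nl l + 1))
            - nl l * (min R r * Real.log 2)) := by
      intro l σ
      rw [hncard l]
      simp_rw [hmem l]
      refine (hsec l D _ (fun z => ?_) σ).trans
        (exponent_bound 𝓧 𝓩 R r (Nat.le_ceil ((nl l : ℝ) * R)))
      have := ball_upper (hnpos l) (x l) dE D z
      rw [hxQ l] at this
      exact this
    have hPlow : ∀ l, ((Fintype.card 𝓧 : ℝ) ^ (nl l) * 2 ^ (⌈(nl l : ℝ) * R⌉₊ : ℕ))⁻¹
        ≤ ⨆ σ : Fin (m l) → (Fin (nl l) → 𝓩),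
        (((typeClass 𝓧 (nl l) Q).ncard : ℝ) * (2 : ℝ) ^ (⌈(nl l : ℝ) * R⌉₊ : ℕ))⁻¹ *
          ∑ x : Fin (nl l) → 𝓧, ∑ u : Fin ⌈(nl l : ℝ) * R⌉₊ → Bool,
            ind (x ∈ typeClass 𝓧 (nl l) Q ∧ seqDist dE x (σ (f l x u)) ≤ D) := by
      intro l
      refine le_trans ?_ (le_ciSup (Set.finite_range _).bddAbove (fun _ => zs ∘ x l))
      have hind : ∀ p : Prop, 0 ≤ ind p := by
        intro p; unfold ind; split_ifs <;> norm_num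
      have h1 : (1 : ℝ) ≤ ∑ x_1 : Fin (nl l) → 𝓧, ∑ u : Fin ⌈(nl l : ℝ) * R⌉₊ → Bool,
            ind (x_1 ∈ typeClass 𝓧 (nl l) Q ∧ seqDist dE x_1 (zs ∘ x l) ≤ D) := by
        have h2 : (1 : ℝ) ≤ ∑ u : Fin ⌈(nl l : ℝ) * R⌉₊ → Bool,
            ind (x l ∈ typeClass 𝓧 (nl l) Q ∧ seqDist dE (x l) (zs ∘ x l) ≤ D) := by
          have h3 : ind (x l ∈ typeClass 𝓧 (nl l) Q ∧ seqDist dE (x l) (zs ∘ x l) ≤ D) = 1 := by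
            unfold ind
            rw [if_pos]
            exact ⟨hx l, by simpa [seqDist, hzs] using hD0⟩
          rw [h3]
          simp only [Finset.sum_const, nsmul_eq_mul, mul_one]
          exact_mod_cast Finset.card_pos.2 Finset.univ_nonempty
        exact h2.trans (Finset.single_le_sum
          (f := fun x_1 => ∑ u : Fin ⌈(nl l : ℝ) * R⌉₊ → Bool,
            ind (x_1 ∈ typeClass 𝓧 (nl l) Q ∧ seqDist dE x_1 (zs ∘ x l) ≤ D))
          (fun _ _ => Finset.sum_nonneg fun _ _ => hind _) (Finset.mem_univ (x l)))
      rw [hncard l]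
      have hT := hTpos l
      have hT2 : ((TC (x l)).card : ℝ) ≤ (Fintype.card 𝓧 : ℝ) ^ (nl l) := by
        have := Finset.card_le_univ (TC (x l))
        rw [Fintype.card_fun, Fintype.card_fin] at this
        exact_mod_cast this
      calc ((Fintype.card 𝓧 : ℝ) ^ (nl l) * 2 ^ (⌈(nl l : ℝ) * R⌉₊ : ℕ))⁻¹
          ≤ (((TC (x l)).card : ℝ) * 2 ^ (⌈(nl l : ℝ) * R⌉₊ : ℕ))⁻¹ := by gcongr
        _ ≤ _ := le_mul_of_one_le_right (by positivity) h1
    have hcX : (0 : ℝ) < Fintype.card 𝓧 := by exact_mod_cast Fintype.card_pos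
    refine Filter.le_liminf_of_le (Filter.isCoboundedUnder_ge_of_le Filter.atTop
      (x := Real.logb 2 (Fintype.card 𝓧) + R + 1) ?_) ?_
    · intro l
      have hlow := hPlow l
      have hposl : (0 : ℝ) < ((Fintype.card 𝓧 : ℝ) ^ (nl l) * 2 ^ (⌈(nl l : ℝ) * R⌉₊ : ℕ))⁻¹ := by
        positivity
      have h1 := Real.logb_le_logb_of_le (b := 2) (by norm_num) hposl hlow
      rw [Real.logb_inv, Real.logb_mul (by positivity) (by positivity), Real.logb_pow,
        Real.logb_pow, Real.logb_self_eq_one (by norm_num)] at h1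
      have h2 := Nat.ceil_lt_add_one (mul_nonneg (hnpos' l).le hR.le)
      have hn1 : (1 : ℝ) ≤ nl l := by exact_mod_cast hnpos l
      rw [neg_mul, ← mul_neg, inv_mul_le_iff₀ (hnpos' l)]
      nlinarith
    · have ev1 := eventually_log_small (kapE 𝓧 𝓩) (δ * Real.log 2) (kapE_nonneg _ _)
        (by positivity)
      filter_upwards [hnl.tendsto_atTop.eventually ev1] with l hl
      have hpos := lt_of_lt_of_le (by positivity) (hPlow l)
      have hle := ciSup_le (hP l)
      have h1 := Real.log_le_log hpos hle
      rw [Real.log_exp] at h1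
      rw [neg_mul, ← mul_neg, le_inv_mul_iff₀ (hnpos' l), Real.logb, ← neg_div, le_div_iff₀ hl2]
      linarith

end
end
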